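/- arXiv:1308.0423 — 2 statements merged into one kernel-verified Lean document; each statement's English description precedes it below -/
import Mathlib

section
/- Let k be any field and let G₄₂ = ⟨σ, τ⟩ act on the rational function field k(x₀,...,x₆) by σ: xᵢ ↦ x_{i+1 mod 7} and τ: xᵢ ↦ x_{3i mod 7}. Then k(x₀,...,x₆)^{G₄₂} is purely transcendental over k. -/
/-- An intermediate field `L` of `E/k` is purely transcendental (rational) over `k`
if `L = k(s)` for some set `s` of elements algebraically independent over `k`. -/
def IsRationalExtension (k : Type*) {E : Type*} [Field k] [Field E] [Algebra k E]
    (L : IntermediateField k E) : Prop :=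
  ∃ s : Set E, AlgebraicIndependent k ((↑) : s → E) ∧ IntermediateField.adjoin k s = L

section
open Polynomial IntermediateField

/-- A simple root of a polynomial over the separable closure of `F` in `E` lies in that closure. -/
theorem mem_separableClosure_of_simple_root {F E : Type*} [Field F] [Field E] [Algebra F E]
    {a : E} (P : (separableClosure F E)[X]) (h0 : aeval a P = 0)
    (h1 : aeval a (derivative P) ≠ 0) : a ∈ separableClosure F E := by
  have hs : IsSeparable (separableClosure F E) a := by
    have hP : P ≠ 0 := by rintro rfl; simp at h1
    have h_int : IsIntegral (separableClosure F E) a :=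
      isAlgebraic_iff_isIntegral.mp ⟨P, hP, h0⟩
    obtain ⟨Q, hQ⟩ := minpoly.dvd _ a h0
    rw [IsSeparable, separable_iff_derivative_ne_zero (minpoly.irreducible h_int)]
    intro hd
    apply h1
    rw [hQ, derivative_mul, hd]
    simp
  have := mem_separableClosure_iff.mpr hs
  rw [separableClosure.separableClosure_eq_bot, mem_bot] at this
  obtain ⟨y, rfl⟩ := this
  exact y.2

theorem mem_separableClosure_of_pow {F E : Type*} [Field F] [Field E] [Algebra F E]
    {a : E} {n : ℕ} (hn : (n : E) ≠ 0) (h : a ^ n ∈ separableClosure F E) :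
    a ∈ separableClosure F E := by
  rcases eq_or_ne a 0 with rfl | ha
  · exact zero_mem _
  refine mem_separableClosure_of_simple_root (X ^ n - C ⟨_, h⟩) ?_ ?_
  · simp [IntermediateField.algebraMap_apply]
  · simp [derivative_X_pow, hn, ha]

open scoped algebraAdjoinAdjoin in
theorem algebraicIndependent_of_isAlgebraic {k K ι : Type*} [Field k] [Field K] [Algebra k K]
    [Finite ι] {x s : ι → K} (hx : AlgebraicIndependent k x)
    (h : Algebra.IsAlgebraic (adjoin k (Set.range s)) K) : AlgebraicIndependent k s := by
  have : Algebra.IsAlgebraic (Algebra.adjoin k (Set.range s)) K :=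
    (IsFractionRing.comap_isAlgebraic_iff (K := adjoin k (Set.range s))).mpr h
  exact (Algebra.IsAlgebraic.isTranscendenceBasis_of_lift_le_trdeg_of_finite k s
    hx.lift_cardinalMk_le_trdeg).1

theorem mem_of_forall_algHom {F K : Type*} [Field F] [Field K] [Algebra F K]
    (hsep : Algebra.IsSeparable F K) {a : K}
    (h : ∀ φ : K →ₐ[F] AlgebraicClosure K, φ a = algebraMap K _ a) :
    a ∈ (algebraMap F K).range := by
  have h_int := Algebra.IsSeparable.isIntegral F a
  rw [← minpoly.natDegree_eq_one_iff, ← card_rootSet_eq_natDegree (K := AlgebraicClosure K)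
    (Algebra.IsSeparable.isSeparable F a) (IsAlgClosed.splits _), Fintype.card_eq_one_iff]
  refine ⟨⟨algebraMap K _ a, ?_⟩, ?_⟩
  · rw [mem_rootSet_of_ne (minpoly.ne_zero h_int)]
    simp [aeval_algebraMap_apply]
  · rintro ⟨y, hy⟩
    rw [mem_rootSet_of_ne (minpoly.ne_zero h_int)] at hy
    obtain ⟨φ, hφ⟩ := exists_algHom_of_splits_of_aeval (F := F) (E := K)
      (fun s => ⟨Algebra.IsSeparable.isIntegral F s, IsAlgClosed.splits _⟩) hy
    simp [← hφ, h]

theorem isSeparable_adjoin_of_generators {k K ι κ : Type*} [Field k] [Field K] [Algebra k K]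
    {x : ι → K} {s : κ → K} (hgen : adjoin k (Set.range x) = ⊤)
    (hsep : ∀ i, algebraMap K (AlgebraicClosure K) (x i) ∈
      separableClosure (adjoin k (Set.range s)) (AlgebraicClosure K)) :
    Algebra.IsSeparable (adjoin k (Set.range s)) K := by
  set F := adjoin k (Set.range s)
  have key : adjoin k (Set.range x) ≤ (separableClosure F K).restrictScalars k := by
    rw [adjoin_le_iff]
    rintro _ ⟨i, rfl⟩
    exact (map_mem_separableClosure_iff
      (IsScalarTower.toAlgHom F K (AlgebraicClosure K))).mp (hsep i)
  rw [← separableClosure.eq_top_iff, eq_top_iff]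
  intro a _
  exact key (hgen ▸ mem_top)

theorem algHom_ext_of_adjoin_eq_top {k K L : Type*} [Field k] [Field K] [Field L] [Algebra k K]
    [Algebra k L] {S : Set K} (hS : adjoin k S = ⊤) {φ ψ : K →ₐ[k] L}
    (h : ∀ x ∈ S, φ x = ψ x) : φ = ψ := by
  ext a
  induction (hS ▸ mem_top : a ∈ adjoin k S) using adjoin_induction with
  | mem x hx => exact h x hx
  | algebraMap r => simp
  | add x y _ _ hx hy => simp [hx, hy]
  | inv x _ hx => simp [hx]
  | mul x y _ _ hx hy => simp [hx, hy]

/-- Galois descent along generators: if every `k`-embedding of `K` in its algebraic closure that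
fixes the `s i` is induced by an element of `G`, then the `s i` generate the fixed field of `G`. -/
theorem isRationalExtension_fixedField {k K ι : Type*} [Field k] [Field K] [Algebra k K]
    [Finite ι] {x s : ι → K} (hx : AlgebraicIndependent k x)
    (hgen : adjoin k (Set.range x) = ⊤) (G : Set (K ≃ₐ[k] K))
    (hfix : ∀ g ∈ G, ∀ i, g (s i) = s i)
    (hsep : ∀ i, algebraMap K (AlgebraicClosure K) (x i) ∈
      separableClosure (adjoin k (Set.range s)) (AlgebraicClosure K))
    (hgal : ∀ φ : K →ₐ[k] AlgebraicClosure K, (∀ i, φ (s i) = algebraMap K _ (s i)) →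
      ∃ g ∈ Subgroup.closure G, ∀ i, φ (x i) = algebraMap K _ (g (x i))) :
    IsRationalExtension k (fixedField (Subgroup.closure G)) := by
  have hs := isSeparable_adjoin_of_generators hgen hsep
  refine ⟨Set.range s, (algebraicIndependent_of_isAlgebraic hx hs.isAlgebraic).coe_range,
    le_antisymm ?_ ?_⟩
  · rw [adjoin_le_iff]
    rintro _ ⟨i, rfl⟩
    simp only [SetLike.mem_coe, mem_fixedField_iff]
    intro g hg
    induction hg using Subgroup.closure_induction with
    | mem g hg => exact hfix g hg i
    | one => rfl
    | mul g h _ _ hg hh => rw [AlgEquiv.mul_apply, hh, hg]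
    | inv g _ hg => rw [AlgEquiv.aut_inv, AlgEquiv.symm_apply_eq, hg]
  · intro a ha
    rw [mem_fixedField_iff] at ha
    obtain ⟨y, hy⟩ := mem_of_forall_algHom hs (a := a) fun φ => by
      obtain ⟨g, hg, hgx⟩ := hgal (φ.restrictScalars k) fun i =>
        φ.commutes ⟨s i, subset_adjoin _ _ ⟨i, rfl⟩⟩
      have : φ.restrictScalars k =
          (IsScalarTower.toAlgHom k K (AlgebraicClosure K)).comp g.toAlgHom := by
        refine algHom_ext_of_adjoin_eq_top hgen ?_
        rintro _ ⟨i, rfl⟩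
        exact hgx i
      have := DFunLike.congr_fun this a
      simpa [ha g hg] using this
    exact hy ▸ y.2

/-- A polynomial that does not vanish at some point does not vanish at an algebraically
independent family. -/
theorem AlgebraicIndependent.aeval_ne_zero {k K R ι : Type*} [Field k] [Field K] [Algebra k K]
    [CommRing R] [Algebra k R] {x : ι → K} (hx : AlgebraicIndependent k x) (P : MvPolynomial ι k)
    (v : ι → R) (hv : MvPolynomial.aeval v P ≠ 0) : MvPolynomial.aeval x P ≠ 0 := by
  intro h
  rw [hx.eq_zero_of_aeval_eq_zero P h, map_zero] at hv
  exact hv rfl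

theorem exists_mem_closure_affine {k K : Type*} [Field k] [Field K] [Algebra k K]
    {x : ZMod 7 → K} {σ τ : K ≃ₐ[k] K} (hσ : ∀ i, σ (x i) = x (i + 1))
    (hτ : ∀ i, τ (x i) = x (3 * i)) {c : ZMod 7} (hc : c ≠ 0) (d : ZMod 7) :
    ∃ g ∈ Subgroup.closure {σ, τ}, ∀ i, g (x i) = x (c * i + d) := by
  have hσn : ∀ (n : ℕ) i, (σ ^ n) (x i) = x (i + n) := by
    intro n
    induction n with
    | zero => simp
    | succ n ih => intro i; rw [pow_succ, AlgEquiv.mul_apply, hσ, ih]; push_cast; ring_nf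
  have hτn : ∀ (n : ℕ) i, (τ ^ n) (x i) = x (3 ^ n * i) := by
    intro n
    induction n with
    | zero => simp
    | succ n ih => intro i; rw [pow_succ, AlgEquiv.mul_apply, hτ, ih]; ring_nf
  obtain ⟨n, rfl⟩ : ∃ n : Fin 6, 3 ^ (n : ℕ) = c := by revert c; decide
  refine ⟨σ ^ d.val * τ ^ (n : ℕ), mul_mem (pow_mem (Subgroup.subset_closure (by simp)) _)
    (pow_mem (Subgroup.subset_closure (by simp)) _), fun i => ?_⟩
  rw [AlgEquiv.mul_apply, hτn, hσn, ZMod.natCast_zmod_val]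

/-- The `j`-th moment about `w` of the weights `x i` placed at the points `c i`. -/
def moment {L : Type*} [Field L] (c : ZMod 7 →+* L) (x : ZMod 7 → L) (w : L) (j : ℕ) : L :=
  ∑ i, (c i - w) ^ j * x i

theorem map_moment {L M : Type*} [Field L] [Field M] (φ : L →+* M) (c : ZMod 7 →+* L)
    (x : ZMod 7 → L) (w : L) (j : ℕ) :
    φ (moment c x w j) = moment (φ.comp c) (φ ∘ x) (φ w) j := by
  simp [moment]

theorem moment_affine {L : Type*} [Field L] (c : ZMod 7 →+* L) (x : ZMod 7 → L) (w : L) (j : ℕ)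
    {a : ZMod 7} (ha : a ≠ 0) (d : ZMod 7) :
    moment c (fun i => x (a * i + d)) (c a⁻¹ * (w - c d)) j = c a⁻¹ ^ j * moment c x w j := by
  have : Fact (Nat.Prime 7) := ⟨by norm_num⟩
  unfold moment
  rw [Finset.mul_sum]
  refine Fintype.sum_equiv ((Equiv.mulLeft₀ a ha).trans (Equiv.addRight d)) _ _ fun i => ?_
  have : c i = c a⁻¹ * c (a * i) := by rw [← map_mul, inv_mul_cancel_left₀ ha]
  simp only [Equiv.trans_apply, Equiv.mulLeft₀_apply, Equiv.coe_addRight]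
  rw [← mul_assoc, ← mul_pow, map_add, this]
  ring_nf

theorem moment_zero {L : Type*} [Field L] (c : ZMod 7 →+* L) (x : ZMod 7 → L) (w : L) :
    moment c x w 0 = ∑ i, x i := by
  simp [moment]

theorem moment_one {L : Type*} [Field L] (c : ZMod 7 →+* L) (x : ZMod 7 → L) (w : L) :
    moment c x w 1 = moment c x 0 1 - w * ∑ i, x i := by
  simp [moment, sub_mul, Finset.sum_sub_distrib, Finset.mul_sum]

theorem moment_one_eq_zero_iff {L : Type*} [Field L] (c : ZMod 7 →+* L) (x : ZMod 7 → L) (w : L)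
    (h : ∑ i, x i ≠ 0) : moment c x w 1 = 0 ↔ w = moment c x 0 1 / ∑ i, x i := by
  rw [moment_one, eq_div_iff h, sub_eq_zero, eq_comm]

theorem mem_of_moment_mem {L : Type*} [Field L] (c : ZMod 7 →+* L) (x : ZMod 7 → L) {w : L}
    {S : Subfield L} (hw : w ∈ S) (h : ∀ j < 7, moment c x w j ∈ S) (m : ZMod 7) : x m ∈ S := by
  have : Fact (Nat.Prime 7) := ⟨by norm_num⟩
  have hc (i : ZMod 7) : c i ∈ S := by
    rw [← ZMod.natCast_zmod_val i, map_natCast]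
    exact natCast_mem S _
  have h6 : ∑ i, (c i - c m) ^ 6 * x i ∈ S := by
    have : ∑ i, (c i - c m) ^ 6 * x i =
        ∑ j ∈ Finset.range 7, (w - c m) ^ (6 - j) * (Nat.choose 6 j) * moment c x w j := by
      simp only [moment, Finset.mul_sum]
      rw [Finset.sum_comm]
      refine Finset.sum_congr rfl fun i _ => ?_
      rw [show c i - c m = (c i - w) + (w - c m) by ring, add_pow, Finset.sum_mul]
      exact Finset.sum_congr rfl fun j _ => by ring
    rw [this]
    exact sum_mem fun j hj => mul_mem (mul_mem (pow_mem (sub_mem hw (hc m)) _)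
      (natCast_mem S _)) (h j (Finset.mem_range.mp hj))
  have hx : x m = ∑ i, x i - ∑ i, (c i - c m) ^ 6 * x i := by
    rw [← Finset.sum_sub_distrib, Finset.sum_eq_single m]
    · simp
    · intro i _ hi
      rw [← map_sub, ← map_pow, ZMod.pow_card_sub_one_eq_one (sub_ne_zero.mpr hi)]
      simp
    · simp
  rw [hx]
  exact sub_mem (moment_zero c x w ▸ h 0 (by norm_num)) h6

theorem exists_affine_of_pow_seven_sub {L : Type*} [Field L] (c : ZMod 7 →+* L) {w w' : L}
    (h0 : w ^ 7 - w ≠ 0) (h : (w' ^ 7 - w') ^ 6 = (w ^ 7 - w) ^ 6) :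
    ∃ a d : ZMod 7, a ≠ 0 ∧ w' = c a * (w - c d) := by
  have : Fact (Nat.Prime 7) := ⟨by norm_num⟩
  have : CharP L 7 := charP_of_injective_ringHom c.injective 7
  have hfix (b : L) (hb : b ^ 7 = b) : ∃ i, c i = b := by
    have hb' := (Subfield.mem_bot_iff_pow_eq_self L 7).mpr hb
    have hle : (⊥ : Subfield L) ≤ c.fieldRange := bot_le
    exact hle hb'
  have hc (i : ZMod 7) : c i ^ 7 = c i := by rw [← map_pow, ZMod.pow_card]
  have h6 : ((w' ^ 7 - w') / (w ^ 7 - w)) ^ 6 = 1 := by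
    rw [div_pow, h, div_self (pow_ne_zero _ h0)]
  obtain ⟨a, ha⟩ := hfix ((w' ^ 7 - w') / (w ^ 7 - w)) (by rw [pow_succ, h6, one_mul])
  have ha0 : a ≠ 0 := by
    rintro rfl
    rw [← ha] at h6
    simp at h6
  have ha1 : w' ^ 7 - w' = c a * (w ^ 7 - w) := by rw [ha, div_mul_cancel₀ _ h0]
  obtain ⟨e, he⟩ := hfix (w' - c a * w) (by
    rw [sub_pow_char, mul_pow, hc]
    linear_combination ha1)
  refine ⟨a, -(a⁻¹ * e), ha0, ?_⟩
  have : c a * c (a⁻¹ * e) = c e := by rw [← map_mul, mul_inv_cancel_left₀ ha0]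
  rw [map_neg]
  linear_combination -he - this

section
variable {k K : Type*} [Field k] [Field K] [Algebra k K]

/-- The barycentre of the weights `x i`. -/
noncomputable def bary (c : ZMod 7 →+* K) (x : ZMod 7 → K) : K := moment c x 0 1 / ∑ i, x i

/-- Generators of the fixed field in characteristic seven. -/
noncomputable def charSevenGen (c : ZMod 7 →+* K) (x : ZMod 7 → K) (j : ZMod 7) : K :=
  if j = 0 then ∑ i, x i
  else if j = 1 then (bary c x ^ 7 - bary c x) ^ 6
  else moment c x (bary c x) j.val / (bary c x ^ 7 - bary c x) ^ j.val

theorem sum_ne_zero_of_algebraicIndependent {x : ZMod 7 → K} (hx : AlgebraicIndependent k x) :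
    ∑ i, x i ≠ 0 := by
  have := hx.aeval_ne_zero (∑ i, MvPolynomial.X i) (Pi.single 0 1 : ZMod 7 → k) (by simp)
  simpa using this

theorem bary_pow_seven_sub_ne_zero (c : ZMod 7 →+* K) {x : ZMod 7 → K}
    (hx : AlgebraicIndependent k x) : bary c x ^ 7 - bary c x ≠ 0 := by
  have : Fact (Nat.Prime 7) := ⟨by norm_num⟩
  have : CharP K 7 := charP_of_injective_ringHom c.injective 7
  intro h
  have hb' := (Subfield.mem_bot_iff_pow_eq_self K 7).mpr (sub_eq_zero.mp h)
  obtain ⟨e, he⟩ : ∃ e, c e = bary c x :=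
    (bot_le : (⊥ : Subfield K) ≤ c.fieldRange) hb'
  have h0 : moment c x (c e) 1 = 0 :=
    (moment_one_eq_zero_iff c x _ (sum_ne_zero_of_algebraicIndependent hx)).mpr he
  have hck (i : ZMod 7) : c i = algebraMap k K (i.val : k) := by
    rw [map_natCast, ← map_natCast c, ZMod.natCast_zmod_val]
  have := Fintype.linearIndependent_iff.mp hx.linearIndependent
    (fun i => (i.val : k) - (e.val : k)) (by
      simpa [moment, hck, Algebra.smul_def] using h0) (e + 1)
  apply_fun algebraMap k K at this
  rw [map_sub, ← hck, ← hck] at this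
  simp at this

theorem charSevenGen_map (c : ZMod 7 →+* K) {x : ZMod 7 → K} (hx : AlgebraicIndependent k x)
    {g : K ≃ₐ[k] K} {a d : ZMod 7} (ha : a ≠ 0) (hg : ∀ i, g (x i) = x (a * i + d)) :
    g (bary c x) = c a⁻¹ * (bary c x - c d) ∧
      ∀ j, g (charSevenGen c x j) = charSevenGen c x j := by
  have : Fact (Nat.Prime 7) := ⟨by norm_num⟩
  have : CharP K 7 := charP_of_injective_ringHom c.injective 7
  have hc (i : ZMod 7) : c i ^ 7 = c i := by rw [← map_pow, ZMod.pow_card]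
  have hN := sum_ne_zero_of_algebraicIndependent hx
  have hgm (w : K) (j : ℕ) : g (moment c x w j) = moment c (fun i => x (a * i + d)) (g w) j := by
    refine (map_moment (g : K →+* K) c x w j).trans ?_
    rw [Subsingleton.elim ((g : K →+* K).comp c) c]
    congr 1
    exact funext hg
  have hs : g (∑ i, x i) = ∑ i, x i := by
    rw [← moment_zero c x (bary c x), hgm, moment_zero, moment_zero]
    exact Fintype.sum_equiv ((Equiv.mulLeft₀ a ha).trans (Equiv.addRight d)) _ _ fun i => rfl
  have hw : g (bary c x) = c a⁻¹ * (bary c x - c d) := by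
    have h0 := (moment_one_eq_zero_iff c x (bary c x) hN).mpr rfl
    have h1 := moment_affine c x (bary c x) 1 ha d
    have h2 := congrArg g h0
    rw [hgm, map_zero] at h2
    rw [h0, mul_zero] at h1
    have hN' : ∑ i, x (a * i + d) ≠ 0 := by
      simpa [← hg, ← map_sum] using hN
    rw [moment_one_eq_zero_iff _ _ _ hN'] at h1 h2
    rw [h1, h2]
  have hf : g (bary c x ^ 7 - bary c x) = c a⁻¹ * (bary c x ^ 7 - bary c x) := by
    rw [map_sub, map_pow, hw, mul_pow, sub_pow_char, hc, hc]
    ring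
  have ha' : c a⁻¹ ≠ 0 := by simpa using ha
  refine ⟨hw, fun j => ?_⟩
  unfold charSevenGen
  split_ifs
  · exact hs
  · rw [map_pow, hf, mul_pow, ← map_pow, ZMod.pow_card_sub_one_eq_one (inv_ne_zero ha)]
    simp
  · rw [map_div₀, map_pow, hf, hgm, hw, moment_affine c x _ _ ha, mul_pow,
      mul_div_mul_left _ _ (pow_ne_zero _ ha')]

theorem mem_of_bary_mem (c : ZMod 7 →+* K) {x : ZMod 7 → K} (hx : AlgebraicIndependent k x)
    {S : Subfield K} (hs : ∀ j, charSevenGen c x j ∈ S) (hw : bary c x ∈ S) (m : ZMod 7) :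
    x m ∈ S := by
  refine mem_of_moment_mem c x hw (fun j hj => ?_) m
  rcases Nat.lt_or_ge j 2 with h2 | h2
  · interval_cases j
    · rw [moment_zero]
      simpa [charSevenGen] using hs 0
    · rw [(moment_one_eq_zero_iff c x (bary c x) (sum_ne_zero_of_algebraicIndependent hx)).mpr rfl]
      exact zero_mem S
  · have hv : (j : ZMod 7).val = j := ZMod.val_natCast_of_lt hj
    have h0 : (j : ZMod 7) ≠ 0 := by
      intro h; rw [h] at hv; simp at hv; omega
    have h1 : (j : ZMod 7) ≠ 1 := by
      intro h; rw [h, ZMod.val_one''] at hv <;> omega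
    have := hs j
    simp only [charSevenGen, h0, h1, if_false, hv] at this
    rw [← div_mul_cancel₀ (moment c x (bary c x) j)
      (pow_ne_zero j (bary_pow_seven_sub_ne_zero c hx))]
    exact mul_mem this (pow_mem (sub_mem (pow_mem hw _) hw) _)

theorem isRationalExtension_of_char_seven [CharP K 7] (x : ZMod 7 → K)
    (hx : AlgebraicIndependent k x) (hgen : adjoin k (Set.range x) = ⊤) (σ τ : K ≃ₐ[k] K)
    (hσ : ∀ i, σ (x i) = x (i + 1)) (hτ : ∀ i, τ (x i) = x (3 * i)) :
    IsRationalExtension k (fixedField (Subgroup.closure {σ, τ})) := by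
  have h31 : (3 : ZMod 7) ≠ 0 := by decide
  have : Fact (Nat.Prime 7) := ⟨by norm_num⟩
  let c : ZMod 7 →+* K := ZMod.castHom dvd_rfl K
  set ι := algebraMap K (AlgebraicClosure K) with hι
  have : CharP (AlgebraicClosure K) 7 := charP_of_injective_ringHom ι.injective 7
  have h7 : (7 : AlgebraicClosure K) = 0 := CharP.cast_eq_zero (AlgebraicClosure K) 7
  have hf0 := bary_pow_seven_sub_ne_zero c hx
  refine isRationalExtension_fixedField (s := charSevenGen c x) hx hgen {σ, τ} ?_ ?_ ?_
  · rintro g (rfl | rfl)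
    · exact (charSevenGen_map c hx (a := 1) (d := 1) one_ne_zero (by simpa using hσ)).2
    · exact (charSevenGen_map c hx (a := 3) (d := 0) h31 (by simpa using hτ)).2
  · set F := adjoin k (Set.range (charSevenGen c x))
    set S := separableClosure F (AlgebraicClosure K)
    have hs (j) : ι (charSevenGen c x j) ∈ S :=
      S.algebraMap_mem ⟨_, subset_adjoin k _ ⟨j, rfl⟩⟩
    have hf : ι (bary c x ^ 7 - bary c x) ∈ S := by
      refine mem_separableClosure_of_pow (n := 6) ?_ (by simpa [charSevenGen] using hs 1)
      rw [Nat.cast_ofNat, show (6 : AlgebraicClosure K) = 7 - 1 by norm_num, h7]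
      simp
    have hw : ι (bary c x) ∈ S := by
      refine mem_separableClosure_of_simple_root (X ^ 7 - X - C ⟨_, hf⟩) ?_ ?_
      · simp [IntermediateField.algebraMap_apply]
      · simp only [derivative_X_pow, derivative_X, derivative_C, map_sub,
          map_mul, map_pow, aeval_X, map_one, sub_zero, map_natCast]
        simp [h7]
    exact mem_of_bary_mem c hx (S := S.toSubfield.comap ι) hs hw
  · intro φ hφ
    have hfφ : (φ (bary c x) ^ 7 - φ (bary c x)) ^ 6 =
        (ι (bary c x) ^ 7 - ι (bary c x)) ^ 6 := by
      simpa [charSevenGen] using hφ 1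
    obtain ⟨a, d, ha, had⟩ := exists_affine_of_pow_seven_sub (ι.comp c)
      (by simpa only [map_sub, map_pow, map_zero] using ι.injective.ne hf0) hfφ
    obtain ⟨g, hg, hgx⟩ := exists_mem_closure_affine hσ hτ (inv_ne_zero ha) d
    obtain ⟨hgw, hgs⟩ := charSevenGen_map c hx (inv_ne_zero ha) hgx
    refine ⟨g, hg, mem_of_bary_mem c hx
      (S := (φ : K →+* AlgebraicClosure K).eqLocusField (ι.comp (g : K →+* K))) ?_ ?_⟩
    · intro j
      exact (hφ j).trans (congrArg ι (hgs j).symm)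
    · refine had.trans ?_
      simp only [inv_inv] at hgw
      change _ = ι (g (bary c x))
      rw [hgw]
      simp
end

theorem zmod_seven_cases {P : ZMod 7 → Prop} (h0 : P 0) (h1 : P 1) (h2 : P 2) (h3 : P 3)
    (h4 : P 4) (h5 : P 5) (h6 : P 6) (j : ZMod 7) : P j := by
  fin_cases j <;> assumption

section
variable {L : Type*} [Field L]

/-- The Fourier transform on `ZMod 7` with respect to the additive character `ψ`. -/
def ft (ψ : AddChar (ZMod 7) L) (f : ZMod 7 → L) (j : ZMod 7) : L := ∑ i, ψ (i * j) * f i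

theorem ft_inversion {ψ : AddChar (ZMod 7) L} (hψ : ψ.IsPrimitive) (f : ZMod 7 → L) (m : ZMod 7) :
    ∑ j, ψ (-(m * j)) * ft ψ f j = 7 * f m := by
  simp only [ft, Finset.mul_sum]
  rw [Finset.sum_comm, Finset.sum_eq_single m]
  · simp [← mul_assoc, ← AddChar.map_add_eq_mul]
  · intro i _ hi
    have := AddChar.sum_mulShift (i - m) hψ
    rw [if_neg (sub_ne_zero.mpr hi)] at this
    rw [← mul_zero (f i), ← Nat.cast_zero (R := L), ← this, Finset.mul_sum]
    refine Finset.sum_congr rfl fun j _ => ?_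
    rw [← mul_assoc, ← AddChar.map_add_eq_mul, mul_comm]
    ring_nf
  · simp

theorem ft_injective {ψ : AddChar (ZMod 7) L} (hψ : ψ.IsPrimitive) (h7 : (7 : L) ≠ 0)
    {f g : ZMod 7 → L} (h : ∀ j, ft ψ f j = ft ψ g j) : f = g := by
  ext m
  refine mul_left_cancel₀ h7 ?_
  rw [← ft_inversion hψ, ← ft_inversion hψ]
  simp [h]

theorem ft_affine (ψ : AddChar (ZMod 7) L) (f : ZMod 7 → L) {a : ZMod 7} (ha : a ≠ 0)
    (d j : ZMod 7) :
    ft ψ (fun i => f (a * i + d)) j = ψ (-(a⁻¹ * d * j)) * ft ψ f (a⁻¹ * j) := by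
  have : Fact (Nat.Prime 7) := ⟨by norm_num⟩
  unfold ft
  rw [Finset.mul_sum]
  refine Fintype.sum_equiv ((Equiv.mulLeft₀ a ha).trans (Equiv.addRight d)) _ _ fun i => ?_
  simp only [Equiv.trans_apply, Equiv.mulLeft₀_apply, Equiv.coe_addRight]
  rw [← mul_assoc, ← AddChar.map_add_eq_mul]
  congr 2
  have := mul_inv_cancel₀ ha
  linear_combination (-i * j) * this

/-- The inverse of `x` for cyclic convolution. -/
noncomputable def convInv (x : ZMod 7 → L) : ZMod 7 → L :=
  (Matrix.circulant x)⁻¹.mulVec (Pi.single 0 1)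

theorem sum_mul_convInv {x : ZMod 7 → L} (h : (Matrix.circulant x).det ≠ 0) (m : ZMod 7) :
    ∑ i, x (m - i) * convInv x i = if m = 0 then 1 else 0 := by
  have := congrFun (Matrix.mulVec_mulVec (Pi.single 0 1) (Matrix.circulant x)
    (Matrix.circulant x)⁻¹) m
  rw [Matrix.mul_nonsing_inv _ h.isUnit, Matrix.one_mulVec] at this
  rw [← Pi.single_apply]
  exact this

/-- Coefficients of `X * ψ₃(X) / ψ₄(X)` in the group ring of `ZMod 7`, where `X = ∑ xᵢ Tⁱ` and
`ψₐ(T) = Tᵃ`. -/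
noncomputable def isogeny (x : ZMod 7 → L) (m : ZMod 7) : L :=
  ∑ a, ∑ b, x a * x b * convInv x (2 * (m - a - 3 * b))

variable {M : Type*} [Field M] {x : ZMod 7 → L} {ψ : AddChar (ZMod 7) M}

theorem ft_mul_ft_convInv (h : (Matrix.circulant x).det ≠ 0) (φ : L →+* M) (j : ZMod 7) :
    ft ψ (φ ∘ x) j * ft ψ (φ ∘ convInv x) j = 1 := by
  have h1 (m) := congrArg φ (sum_mul_convInv h m)
  have h2 : ∑ m, ψ (m * j) * φ (∑ i, x (m - i) * convInv x i) = 1 := by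
    simp [h1]
  rw [← h2]
  simp only [ft, map_sum, map_mul, Finset.mul_sum, Finset.sum_mul]
  conv_rhs => rw [Finset.sum_comm]
  refine Finset.sum_congr rfl fun i _ => ?_
  refine Fintype.sum_equiv (Equiv.addRight i) _ _ fun m => ?_
  simp only [Equiv.coe_addRight, add_sub_cancel_right, add_mul, AddChar.map_add_eq_mul,
    Function.comp_apply]
  ring

theorem ft_ne_zero (h : (Matrix.circulant x).det ≠ 0) (φ : L →+* M) (j : ZMod 7) :
    ft ψ (φ ∘ x) j ≠ 0 :=
  left_ne_zero_of_mul_eq_one (ft_mul_ft_convInv h φ j)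

theorem ft_isogeny (h : (Matrix.circulant x).det ≠ 0) (φ : L →+* M) (j : ZMod 7) :
    ft ψ (φ ∘ x) j * ft ψ (φ ∘ x) (3 * j) =
      ft ψ (φ ∘ isogeny x) j * ft ψ (φ ∘ x) (4 * j) := by
  have h20 : (2 : ZMod 7) ≠ 0 := by decide
  have h8 : (8 : ZMod 7) = 1 := by decide
  have key : ft ψ (φ ∘ isogeny x) j =
      ft ψ (φ ∘ x) j * ft ψ (φ ∘ x) (3 * j) * ft ψ (φ ∘ convInv x) (4 * j) := by
    have : Fact (Nat.Prime 7) := ⟨by norm_num⟩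
    simp only [ft, isogeny, Function.comp_apply, map_sum, map_mul]
    rw [Finset.sum_mul_sum, Finset.sum_mul]
    simp only [Finset.mul_sum, Finset.sum_mul]
    rw [Finset.sum_comm]
    refine Finset.sum_congr rfl fun a _ => ?_
    rw [Finset.sum_comm]
    conv_rhs => rw [Finset.sum_comm]
    refine Finset.sum_congr rfl fun b _ => ?_
    refine Fintype.sum_equiv ((Equiv.subRight (a + 3 * b)).trans (Equiv.mulLeft₀ 2 h20)) _ _
      fun m => ?_
    simp only [Equiv.trans_apply, Equiv.mulLeft₀_apply, Equiv.subRight_apply]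
    have h3 : ψ (m * j) =
        ψ (a * j) * ψ (b * (3 * j)) * ψ (2 * (m - (a + 3 * b)) * (4 * j)) := by
      rw [← AddChar.map_add_eq_mul, ← AddChar.map_add_eq_mul]
      congr 1
      linear_combination -(m - (a + 3 * b)) * j * h8
    rw [h3, sub_sub]
    ring
  rw [key, mul_assoc, mul_comm (ft ψ (φ ∘ convInv x) _), ft_mul_ft_convInv h, mul_one]

theorem isogeny_map {g : L →+* L} (h7 : (7 : M) ≠ 0) (hψ : ψ.IsPrimitive) (φ : L →+* M)
    (h : (Matrix.circulant x).det ≠ 0) {a d : ZMod 7} (ha : a ≠ 0)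
    (hg : ∀ i, g (x i) = x (a * i + d)) (m : ZMod 7) :
    g (isogeny x m) = isogeny x (a * m) := by
  have : Fact (Nat.Prime 7) := ⟨by norm_num⟩
  have key : (φ.comp g) ∘ isogeny x = fun i => (φ ∘ isogeny x) (a * i + 0) := by
    refine ft_injective hψ h7 fun j => ?_
    have h1 (j) : ft ψ ((φ.comp g) ∘ x) j =
        ψ (-(a⁻¹ * d * j)) * ft ψ (φ ∘ x) (a⁻¹ * j) := by
      rw [← ft_affine ψ _ ha]
      simp [Function.comp_def, hg]
    have h2 := ft_isogeny (ψ := ψ) h (φ.comp g) j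
    have h3 := ft_isogeny (ψ := ψ) h φ (a⁻¹ * j)
    have h4 := ft_ne_zero (ψ := ψ) h (φ.comp g) (4 * j)
    rw [ft_affine ψ _ ha]
    refine mul_right_cancel₀ h4 ?_
    rw [← h2, h1, h1, h1]
    have h5 : ψ (-(a⁻¹ * d * j)) * ψ (-(a⁻¹ * d * (3 * j))) = ψ (-(a⁻¹ * d * (4 * j))) := by
      rw [← AddChar.map_add_eq_mul]; ring_nf
    rw [show a⁻¹ * (3 * j) = 3 * (a⁻¹ * j) by ring, show a⁻¹ * (4 * j) = 4 * (a⁻¹ * j) by ring]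
    simp only [mul_zero, zero_mul, neg_zero, AddChar.map_zero_eq_one, one_mul]
    rw [← h5]
    linear_combination ψ (-(a⁻¹ * d * j)) * ψ (-(a⁻¹ * d * (3 * j))) * h3
  refine φ.injective ?_
  simpa using congrFun key m

theorem isogeny_solve {R Z : ZMod 7 → M} (hR : ∀ j, R j ≠ 0) (hZ : ∀ j, Z j ≠ 0)
    (h : ∀ j, R j * R (3 * j) = Z j * R (4 * j)) :
    R 4 ^ 7 = Z 3 ^ 4 * Z 4 ^ 3 * Z 5 * Z 6 ^ 2 / (Z 1 ^ 2 * Z 2) ∧ R 0 = Z 0 ∧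
      R 1 = Z 1 * R 4 ^ 2 / (Z 3 * Z 4) ∧ R 5 = Z 1 * Z 5 * Z 6 / R 1 ^ 2 ∧
      R 3 = Z 1 * R 4 / R 1 ∧ R 6 = R 5 * R 1 / Z 5 ∧ R 2 = R 4 * R 5 / Z 4 := by
  have e0 : R 0 * R 0 = Z 0 * R 0 := h 0
  have e1 : R 1 * R 3 = Z 1 * R 4 := h 1
  have e2 : R 2 * R 6 = Z 2 * R 1 := h 2
  have e3 : R 3 * R 2 = Z 3 * R 5 := h 3
  have e4 : R 4 * R 5 = Z 4 * R 2 := h 4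
  have e5 : R 5 * R 1 = Z 5 * R 6 := h 5
  have e6 : R 6 * R 4 = Z 6 * R 3 := h 6
  have r3 : R 3 = Z 1 * R 4 / R 1 := by rw [eq_div_iff (hR 1), ← e1]; ring
  have r6 : R 6 = R 5 * R 1 / Z 5 := by rw [eq_div_iff (hZ 5), e5]; ring
  have r2 : R 2 = R 4 * R 5 / Z 4 := by rw [eq_div_iff (hZ 4), e4]; ring
  have h1 := hR 1
  have h4 := hR 4
  have h5 := hR 5
  have z1 := hZ 1
  have z2 := hZ 2
  have z3 := hZ 3
  have z4 := hZ 4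
  have z5 := hZ 5
  have z6 := hZ 6
  have r1 : R 1 = Z 1 * R 4 ^ 2 / (Z 3 * Z 4) := by
    rw [r3, r2] at e3
    field_simp at e3 ⊢
    linear_combination -e3
  have r5 : R 5 = Z 1 * Z 5 * Z 6 / R 1 ^ 2 := by
    rw [r6, r3] at e6
    field_simp at e6 ⊢
    linear_combination e6
  refine ⟨?_, mul_right_cancel₀ (hR 0) e0, r1, r5, r3, r6, r2⟩
  rw [r2, r6] at e2
  rw [r1] at r5
  field_simp at e2
  rw [r5] at e2
  field_simp at e2 ⊢
  linear_combination -e2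

/-- The separable closure contains every `x i` as soon as it contains the `isogeny x i`. -/
theorem mem_of_isogeny_mem {F : Type*} [Field F] [Algebra F M] (h7 : (7 : M) ≠ 0)
    (hψ : ψ.IsPrimitive) (h : (Matrix.circulant x).det ≠ 0) (φ : L →+* M)
    (hz : ∀ i, φ (isogeny x i) ∈ separableClosure F M) (m : ZMod 7) :
    φ (x m) ∈ separableClosure F M := by
  set S := separableClosure F M
  have hψS (i) : ψ i ∈ S := by
    refine mem_separableClosure_of_pow (n := 7) (by simpa using h7) ?_
    rw [← AddChar.map_nsmul_eq_pow, nsmul_eq_mul, show ((7 : ℕ) : ZMod 7) = 0 from rfl, zero_mul,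
      AddChar.map_zero_eq_one]
    exact one_mem S
  have hZ (j) : ft ψ (φ ∘ isogeny x) j ∈ S := sum_mem fun i _ => mul_mem (hψS _) (hz i)
  have h0 := ft_ne_zero (ψ := ψ) h φ
  obtain ⟨h4, r0, r1, r5, r3, r6, r2⟩ := isogeny_solve h0 (fun j hj => by
    have := ft_isogeny (ψ := ψ) h φ j
    rw [hj, zero_mul] at this
    exact mul_ne_zero (h0 _) (h0 _) this) (ft_isogeny (ψ := ψ) h φ)
  have m4 : ft ψ (φ ∘ x) 4 ∈ S := by
    refine mem_separableClosure_of_pow (n := 7) (by simpa using h7) ?_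
    rw [h4]
    exact div_mem (mul_mem (mul_mem (mul_mem (pow_mem (hZ _) _) (pow_mem (hZ _) _)) (hZ _))
      (pow_mem (hZ _) _)) (mul_mem (pow_mem (hZ _) _) (hZ _))
  have m0 : ft ψ (φ ∘ x) 0 ∈ S := r0 ▸ hZ 0
  have m1 : ft ψ (φ ∘ x) 1 ∈ S := by
    rw [r1]; exact div_mem (mul_mem (hZ _) (pow_mem m4 _)) (mul_mem (hZ _) (hZ _))
  have m5 : ft ψ (φ ∘ x) 5 ∈ S := by
    rw [r5]; exact div_mem (mul_mem (mul_mem (hZ _) (hZ _)) (hZ _)) (pow_mem m1 _)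
  have m3 : ft ψ (φ ∘ x) 3 ∈ S := by
    rw [r3]; exact div_mem (mul_mem (hZ _) m4) m1
  have m6 : ft ψ (φ ∘ x) 6 ∈ S := by
    rw [r6]; exact div_mem (mul_mem m5 m1) (hZ _)
  have m2 : ft ψ (φ ∘ x) 2 ∈ S := by
    rw [r2]; exact div_mem (mul_mem m4 m5) (hZ _)
  have hR (j : ZMod 7) : ft ψ (φ ∘ x) j ∈ S := zmod_seven_cases
    (P := fun j => ft ψ (φ ∘ x) j ∈ S) m0 m1 m2 m3 m4 m5 m6 j
  have h7m := ft_inversion hψ (φ ∘ x) m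
  rw [Function.comp_apply] at h7m
  rw [← mul_div_cancel_left₀ (φ (x m)) h7, ← h7m]
  exact div_mem (sum_mem fun j _ => mul_mem (hψS _) (hR j)) (ofNat_mem S 7)

theorem isogeny_kernel {R : ZMod 7 → M} (hR : ∀ j, R j ≠ 0)
    (h : ∀ j, R j * R (3 * j) = R (4 * j)) :
    R 1 ^ 7 = 1 ∧ ∀ j, R j = R 1 ^ j.val := by
  obtain ⟨h4, r0, r1, r5, r3, r6, r2⟩ := isogeny_solve (Z := fun _ => 1) hR
    (fun _ => one_ne_zero) (fun j => by rw [h, one_mul])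
  have hu := hR 4
  simp only [one_pow, mul_one, div_one, one_mul, one_div] at h4 r0 r1 r5 r3 r6 r2
  rw [r1] at r5 r3 r6
  have s5 : R 5 = R 4 ^ 3 := by
    rw [r5]; field_simp; linear_combination -h4
  have s3 : R 3 = R 4 ^ 6 := by
    rw [r3]; field_simp; linear_combination -h4
  rw [s5] at r6 r2
  have key (n : ℕ) (m : ℕ) : R 4 ^ (n + 7 * m) = R 4 ^ n := by
    rw [pow_add, pow_mul, h4, one_pow, mul_one]
  refine ⟨by rw [r1, ← pow_mul]; exact (key 0 2).trans (pow_zero _), fun j => ?_⟩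
  rw [r1, ← pow_mul]
  exact zmod_seven_cases (P := fun j : ZMod 7 => R j = R 4 ^ (2 * j.val))
    (r0.trans (pow_zero _).symm) r1 (r2.trans (pow_succ' _ _).symm) s3
    ((pow_one _).symm.trans (key 1 1).symm) (s5.trans (key 3 1).symm)
    ((r6.trans (pow_add _ 3 2).symm).trans (key 5 1).symm) j

theorem exists_translate_of_isogeny {ζ : M} (hζ : IsPrimitiveRoot ζ 7) (h7 : (7 : M) ≠ 0)
    (h : (Matrix.circulant x).det ≠ 0) (φ φ' : L →+* M) {a : ZMod 7} (ha : a ≠ 0)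
    (hz : ∀ i, φ' (isogeny x i) = φ (isogeny x (a * i))) :
    ∃ d, ∀ i, φ' (x i) = φ (x (a * i + d)) := by
  have : Fact (Nat.Prime 7) := ⟨by norm_num⟩
  obtain ⟨ψ, hψ, hψζ⟩ : ∃ ψ : AddChar (ZMod 7) M, ψ.IsPrimitive ∧ ∀ n : ℕ, ψ n = ζ ^ n :=
    ⟨_, AddChar.zmodChar_primitive_of_primitive_root 7 hζ, fun n => AddChar.zmodChar_apply' _ n⟩
  have h0 := ft_ne_zero (ψ := ψ) h φ
  have h0' := ft_ne_zero (ψ := ψ) h φ'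
  have hzz : φ' ∘ isogeny x = fun i => (φ ∘ isogeny x) (a * i + 0) := by
    ext i; simpa using hz i
  obtain ⟨hp, hR⟩ := isogeny_kernel (R := fun j => ft ψ (φ' ∘ x) j / ft ψ (φ ∘ x) (a⁻¹ * j))
    (fun j => div_ne_zero (h0' _) (h0 _)) (fun j => by
      have e1 := ft_isogeny (ψ := ψ) h φ' j
      have e2 := ft_isogeny (ψ := ψ) h φ (a⁻¹ * j)
      rw [hzz, ft_affine ψ _ ha, mul_zero, zero_mul, neg_zero, AddChar.map_zero_eq_one,
        one_mul] at e1
      rw [mul_left_comm a⁻¹ 3 j, mul_left_comm a⁻¹ 4 j, div_mul_div_comm,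
        div_eq_div_iff (mul_ne_zero (h0 _) (h0 _)) (h0 _), e1, e2]
      ring)
  obtain ⟨n, -, hζn⟩ := hζ.eq_pow_of_pow_eq_one hp
  refine ⟨-(a * n), fun i => ?_⟩
  refine congrFun (ft_injective hψ h7 (f := φ' ∘ x)
    (g := fun i => (φ ∘ x) (a * i + -(a * n))) fun j => ?_) i
  rw [ft_affine ψ _ ha, ← div_eq_iff (h0 _)]
  refine (hR j).trans ?_
  rw [← hζn, ← pow_mul, ← hψζ, Nat.cast_mul, ZMod.natCast_zmod_val, mul_neg,
    inv_mul_cancel_left₀ ha, neg_mul, neg_neg]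

end

section
variable {L M : Type*} [Field L] [Field M]

theorem mem_of_linear_system_three {S : Subfield L} {a b c d e f g h i x y z r s t : L}
    (ha : a ∈ S) (hb : b ∈ S) (hc : c ∈ S) (hd : d ∈ S) (he : e ∈ S) (hf : f ∈ S) (hg : g ∈ S)
    (hh : h ∈ S) (hi : i ∈ S) (hr : r ∈ S) (hs : s ∈ S) (ht : t ∈ S)
    (h1 : a * x + b * y + c * z = r) (h2 : d * x + e * y + f * z = s)
    (h3 : g * x + h * y + i * z = t)
    (hdet : a * (e * i - f * h) - b * (d * i - f * g) + c * (d * h - e * g) ≠ 0) :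
    x ∈ S ∧ y ∈ S ∧ z ∈ S := by
  have minor {a b c d : L} (ha : a ∈ S) (hb : b ∈ S) (hc : c ∈ S) (hd : d ∈ S) :
      a * b - c * d ∈ S := sub_mem (mul_mem ha hb) (mul_mem hc hd)
  have hdetS := add_mem (sub_mem (mul_mem ha (minor he hi hf hh)) (mul_mem hb (minor hd hi hf hg)))
    (mul_mem hc (minor hd hh he hg))
  refine ⟨?_, ?_, ?_⟩
  · rw [show x = (r * (e * i - f * h) - s * (b * i - c * h) + t * (b * f - c * e)) /
        (a * (e * i - f * h) - b * (d * i - f * g) + c * (d * h - e * g)) by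
      rw [eq_div_iff hdet, ← h1, ← h2, ← h3]; ring]
    exact div_mem (add_mem (sub_mem (mul_mem hr (minor he hi hf hh))
      (mul_mem hs (minor hb hi hc hh))) (mul_mem ht (minor hb hf hc he))) hdetS
  · rw [show y = (s * (a * i - c * g) - r * (d * i - f * g) + t * (c * d - a * f)) /
        (a * (e * i - f * h) - b * (d * i - f * g) + c * (d * h - e * g)) by
      rw [eq_div_iff hdet, ← h1, ← h2, ← h3]; ring]
    exact div_mem (add_mem (sub_mem (mul_mem hs (minor ha hi hc hg))
      (mul_mem hr (minor hd hi hf hg))) (mul_mem ht (minor hc hd ha hf))) hdetS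
  · rw [show z = (r * (d * h - e * g) - s * (a * h - b * g) + t * (a * e - b * d)) /
        (a * (e * i - f * h) - b * (d * i - f * g) + c * (d * h - e * g)) by
      rw [eq_div_iff hdet, ← h1, ← h2, ← h3]; ring]
    exact div_mem (add_mem (sub_mem (mul_mem hr (minor hd hh he hg))
      (mul_mem hs (minor ha hh hb hg))) (mul_mem ht (minor ha he hb hd))) hdetS

/-- The cross-ratio-like expression `-(b - c) / (a - b)`, permuted by cyclic rotation as an
order three Möbius transformation. -/
def cyclicRatio (a b c : L) : L := -(b - c) / (a - b)

theorem cyclicRatio_mul {a b c : L} (h1 : a - b ≠ 0) (h2 : b - c ≠ 0) :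
    cyclicRatio a b c * cyclicRatio b c a = cyclicRatio a b c - 1 := by
  unfold cyclicRatio
  field_simp
  ring

/-- The sum of `z` over the nonzero squares of `ZMod 7`. -/
def squareSum (z : ZMod 7 → L) : L := z 1 + z 2 + z 4

/-- The sum of `z` over the nonsquares of `ZMod 7`. -/
def nonsquareSum (z : ZMod 7 → L) : L := z 3 + z 5 + z 6

/-- A generator of the cyclic cubic layer. -/
def cubicGen (z : ZMod 7 → L) : L := cyclicRatio (z 1 + z 6) (z 3 + z 4) (z 2 + z 5)

/-- Generators of the invariants of `zᵢ ↦ z₃ᵢ`. -/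
def sexticInvariant (z : ZMod 7 → L) : Fin 7 → L :=
  let p := squareSum z
  let q := nonsquareSum z
  let t₀ := cyclicRatio (z 1 + z 6) (z 3 + z 4) (z 2 + z 5)
  let t₁ := cyclicRatio (z 3 + z 4) (z 2 + z 5) (z 1 + z 6)
  let t₂ := cyclicRatio (z 2 + z 5) (z 1 + z 6) (z 3 + z 4)
  ![z 0, p + q, p * q, t₀ + t₁ + t₂,
    t₀ * (z 1 + z 6) + t₁ * (z 3 + z 4) + t₂ * (z 2 + z 5),
    t₀ * (p * z 1 + q * z 6) + t₁ * (p * z 4 + q * z 3) + t₂ * (p * z 2 + q * z 5),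
    t₁ * (p * z 1 + q * z 6) + t₂ * (p * z 4 + q * z 3) + t₀ * (p * z 2 + q * z 5)]

theorem map_cyclicRatio (φ : L →+* M) (a b c : L) :
    φ (cyclicRatio a b c) = cyclicRatio (φ a) (φ b) (φ c) := by
  simp [cyclicRatio]

theorem map_sexticInvariant (φ : L →+* M) (z : ZMod 7 → L) (j : Fin 7) :
    φ (sexticInvariant z j) = sexticInvariant (φ ∘ z) j := by
  fin_cases j <;> simp [sexticInvariant, map_cyclicRatio, squareSum, nonsquareSum]

theorem sexticInvariant_three_mul (z : ZMod 7 → L) :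
    sexticInvariant (fun i => z (3 * i)) = sexticInvariant z := by
  have e (a b : ZMod 7) (h : 3 * a = b) : z (3 * a) = z b := by rw [h]
  unfold sexticInvariant squareSum nonsquareSum
  simp only [e 0 0 (by decide), e 1 3 (by decide), e 2 6 (by decide), e 3 2 (by decide),
    e 4 5 (by decide), e 5 1 (by decide), e 6 4 (by decide)]
  rw [add_comm (z 6) (z 1)]
  ext j
  fin_cases j <;> simp <;> ring

theorem sexticInvariant_mul (z : ZMod 7 → L) {a : ZMod 7} (ha : a ≠ 0) :
    sexticInvariant (fun i => z (a * i)) = sexticInvariant z := by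
  obtain ⟨n, rfl⟩ : ∃ n : Fin 6, 3 ^ (n : ℕ) = a := by revert a; decide
  induction (n : ℕ) with
  | zero => simp
  | succ n ih =>
    rw [← ih, ← sexticInvariant_three_mul fun i => z (3 ^ n * i)]
    simp only [pow_succ, mul_assoc]

/-- The nonvanishing conditions under which the `sexticInvariant`s separate orbits. -/
structure IsSexticGeneric (z : ZMod 7 → L) : Prop where
  sub₀₁ : (z 1 + z 6) - (z 3 + z 4) ≠ 0
  sub₁₂ : (z 3 + z 4) - (z 2 + z 5) ≠ 0
  sub₂₀ : (z 2 + z 5) - (z 1 + z 6) ≠ 0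
  squareSum_sub : squareSum z - nonsquareSum z ≠ 0
  sq_sub_add_one : cubicGen z ^ 2 - cubicGen z + 1 ≠ 0
  det : cyclicRatio (z 1 + z 6) (z 3 + z 4) (z 2 + z 5) ^ 2 +
    cyclicRatio (z 3 + z 4) (z 2 + z 5) (z 1 + z 6) ^ 2 +
    cyclicRatio (z 2 + z 5) (z 1 + z 6) (z 3 + z 4) ^ 2 -
    (sexticInvariant z 3 - 3) ≠ 0

theorem mem_of_sexticInvariant_mem {S : Subfield L} {z : ZMod 7 → L} (hz : IsSexticGeneric z)
    (h : ∀ j, sexticInvariant z j ∈ S) (hp : squareSum z ∈ S) (ht : cubicGen z ∈ S)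
    (i : ZMod 7) : z i ∈ S := by
  obtain ⟨h01, h12, h20, hpq, ht1, hdet⟩ := hz
  have t01 := cyclicRatio_mul h01 h12
  have t12 := cyclicRatio_mul h12 h20
  have t20 := cyclicRatio_mul h20 h01
  have key : (z 1 + z 6 - (z 3 + z 4)) * cyclicRatio (z 1 + z 6) (z 3 + z 4) (z 2 + z 5) =
      -((z 3 + z 4) - (z 2 + z 5)) := mul_div_cancel₀ _ h01
  have g0 := h 0
  have g1 := h 1
  have g3 := h 3
  have g4 := h 4
  have g5 := h 5
  have g6 := h 6
  simp only [sexticInvariant, cubicGen, Matrix.cons_val] at g0 g1 g3 g4 g5 g6 hdet ht ht1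
  generalize hT0 : cyclicRatio (z 1 + z 6) (z 3 + z 4) (z 2 + z 5) = t₀ at *
  generalize hT1 : cyclicRatio (z 3 + z 4) (z 2 + z 5) (z 1 + z 6) = t₁ at *
  generalize hT2 : cyclicRatio (z 2 + z 5) (z 1 + z 6) (z 3 + z 4) = t₂ at *
  have hq : nonsquareSum z ∈ S := by simpa using sub_mem g1 hp
  have n0 : t₀ ≠ 0 := by
    rw [← hT0]; exact div_ne_zero (neg_ne_zero.mpr h12) h01
  have n1 : t₀ - 1 ≠ 0 := by
    rw [← t01, ← hT1]; exact mul_ne_zero n0 (div_ne_zero (neg_ne_zero.mpr h20) h12)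
  have m1 : t₁ ∈ S := by
    rw [eq_div_of_mul_eq n0 ((mul_comm _ _).trans t01)]
    exact div_mem (sub_mem ht (one_mem _)) ht
  have m2 : t₂ ∈ S := by
    simpa [add_assoc] using sub_mem g3 (add_mem ht m1)
  have t2' : (1 - t₀) * t₂ = 1 := by linear_combination -t20
  obtain ⟨b0, b1, b2⟩ := mem_of_linear_system_three (S := S) (one_mem S) (one_mem S) (one_mem S)
    ht (sub_mem (one_mem S) ht) (neg_mem (one_mem S)) ht m1 m2 g1 (zero_mem S) g4
    (x := z 1 + z 6) (y := z 3 + z 4) (z := z 2 + z 5)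
    (by unfold squareSum nonsquareSum; ring) (by linear_combination key) rfl (by
      intro h
      have : (t₀ ^ 2 - t₀ + 1) ^ 2 = 0 := by
        linear_combination (-t₀ * (1 - t₀)) * h + (1 - t₀ ^ 2) * t01 - t₀ * (1 - 2 * t₀) * t20
      exact ht1 (pow_eq_zero_iff two_ne_zero |>.mp this))
  obtain ⟨w0, w1, w2⟩ := mem_of_linear_system_three (S := S) (one_mem S) (one_mem S) (one_mem S)
    ht m1 m2 m1 m2 ht (add_mem (pow_mem hp 2) (pow_mem hq 2)) g5 g6
    (x := squareSum z * z 1 + nonsquareSum z * z 6)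
    (y := squareSum z * z 4 + nonsquareSum z * z 3)
    (z := squareSum z * z 2 + nonsquareSum z * z 5)
    (by unfold squareSum nonsquareSum; ring) rfl rfl (by
      intro h
      apply hdet
      linear_combination -h + t01 + t12 + t20)
  have solve {x y : L} (h1 : x + y ∈ S) (h2 : squareSum z * x + nonsquareSum z * y ∈ S) :
      x ∈ S ∧ y ∈ S := by
    refine ⟨?_, ?_⟩
    · rw [show x = (squareSum z * x + nonsquareSum z * y - nonsquareSum z * (x + y)) /
        (squareSum z - nonsquareSum z) by rw [eq_div_iff hpq]; ring]
      exact div_mem (sub_mem h2 (mul_mem hq h1)) (sub_mem hp hq)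
    · rw [show y = (squareSum z * (x + y) - (squareSum z * x + nonsquareSum z * y)) /
        (squareSum z - nonsquareSum z) by rw [eq_div_iff hpq]; ring]
      exact div_mem (sub_mem (mul_mem hp h1) h2) (sub_mem hp hq)
  obtain ⟨z1, z6⟩ := solve b0 w0
  obtain ⟨z4, z3⟩ := solve (add_comm (z 3) _ ▸ b1) w1
  obtain ⟨z2, z5⟩ := solve b2 w2
  exact zmod_seven_cases (P := fun i => z i ∈ S) g0 z1 z2 z3 z4 z5 z6 i

end

section
variable {L M : Type*} [Field L] [Field M]

theorem prod_sub_of_cyclic {a b c : L} (hab : a * b = a - 1) (hbc : b * c = b - 1)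
    (hca : c * a = c - 1) (y : L) :
    (y - a) * (y - b) * (y - c) = y ^ 3 - (a + b + c) * y ^ 2 + ((a + b + c) - 3) * y + 1 := by
  linear_combination (y - c) * hab + y * hbc + (y - 1) * hca

theorem cubicGen_root {z : ZMod 7 → L} (hz : IsSexticGeneric z) :
    cubicGen z ^ 3 - sexticInvariant z 3 * cubicGen z ^ 2 +
      (sexticInvariant z 3 - 3) * cubicGen z + 1 = 0 := by
  refine (prod_sub_of_cyclic (cyclicRatio_mul hz.sub₀₁ hz.sub₁₂)
    (cyclicRatio_mul hz.sub₁₂ hz.sub₂₀) (cyclicRatio_mul hz.sub₂₀ hz.sub₀₁) _).symm.trans ?_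
  rw [cubicGen, sub_self, zero_mul, zero_mul]

theorem cubicGen_simple_root {z : ZMod 7 → L} (hz : IsSexticGeneric z) :
    3 * cubicGen z ^ 2 - sexticInvariant z 3 * (2 * cubicGen z) +
      (sexticInvariant z 3 - 3) ≠ 0 := by
  have t01 := cyclicRatio_mul hz.sub₀₁ hz.sub₁₂
  have t20 := cyclicRatio_mul hz.sub₂₀ hz.sub₀₁
  have h := hz.sq_sub_add_one
  simp only [sexticInvariant, cubicGen, Matrix.cons_val] at h ⊢
  generalize cyclicRatio (z 1 + z 6) (z 3 + z 4) (z 2 + z 5) = t₀ at *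
  generalize cyclicRatio (z 3 + z 4) (z 2 + z 5) (z 1 + z 6) = t₁ at *
  generalize cyclicRatio (z 2 + z 5) (z 1 + z 6) (z 3 + z 4) = t₂ at *
  intro h0
  have : (t₀ ^ 2 - t₀ + 1) ^ 2 = 0 := by
    linear_combination (t₀ * (t₀ - 1)) * h0 - (t₀ - 1) * (1 - 2 * t₀) * t01 -
      t₀ * (1 - 2 * t₀) * t20
  exact h (pow_eq_zero_iff two_ne_zero |>.mp this)

/-- Two embeddings that agree on the `sexticInvariant`s agree on `squareSum` and `cubicGen` up to a
permutation `zᵢ ↦ z_{ai}`. -/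
theorem exists_mul_of_sexticInvariant {z : ZMod 7 → L} (hz : IsSexticGeneric z)
    (φ φ' : L →+* M) (h : ∀ j, φ' (sexticInvariant z j) = φ (sexticInvariant z j)) :
    ∃ a : ZMod 7, a ≠ 0 ∧ φ' (squareSum z) = φ (squareSum fun i => z (a * i)) ∧
      φ' (cubicGen z) = φ (cubicGen fun i => z (a * i)) := by
  have hp : (φ' (squareSum z) - φ (squareSum z)) * (φ' (squareSum z) - φ (nonsquareSum z)) = 0 := by
    have h1 := h 1
    have h2 := h 2
    simp only [sexticInvariant, Matrix.cons_val, map_add, map_mul] at h1 h2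
    linear_combination φ' (squareSum z) * h1 - h2
  have ht : (φ' (cubicGen z) - φ (cyclicRatio (z 1 + z 6) (z 3 + z 4) (z 2 + z 5))) *
      (φ' (cubicGen z) - φ (cyclicRatio (z 3 + z 4) (z 2 + z 5) (z 1 + z 6))) *
      (φ' (cubicGen z) - φ (cyclicRatio (z 2 + z 5) (z 1 + z 6) (z 3 + z 4))) = 0 := by
    have t01 := congrArg φ (cyclicRatio_mul hz.sub₀₁ hz.sub₁₂)
    have t12 := congrArg φ (cyclicRatio_mul hz.sub₁₂ hz.sub₂₀)
    have t20 := congrArg φ (cyclicRatio_mul hz.sub₂₀ hz.sub₀₁)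
    have h0 := congrArg φ' (cubicGen_root hz)
    rw [map_mul, map_sub, map_one] at t01 t12 t20
    rw [prod_sub_of_cyclic t01 t12 t20, ← map_add, ← map_add]
    change φ' (cubicGen z) ^ 3 - φ (sexticInvariant z 3) * φ' (cubicGen z) ^ 2 +
      (φ (sexticInvariant z 3) - 3) * φ' (cubicGen z) + 1 = 0
    simpa only [map_add, map_sub, map_mul, map_pow, map_one, map_ofNat, map_zero, h 3] using h0
  have p1 : squareSum (fun i => z (1 * i)) = squareSum z := rfl
  have p2 : squareSum (fun i => z (2 * i)) = squareSum z := by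
    change z 2 + z 4 + z 1 = z 1 + z 2 + z 4; ring
  have p3 : squareSum (fun i => z (3 * i)) = nonsquareSum z := by
    change z 3 + z 6 + z 5 = z 3 + z 5 + z 6; ring
  have p4 : squareSum (fun i => z (4 * i)) = squareSum z := by
    change z 4 + z 1 + z 2 = z 1 + z 2 + z 4; ring
  have p5 : squareSum (fun i => z (5 * i)) = nonsquareSum z := by
    change z 5 + z 3 + z 6 = z 3 + z 5 + z 6; ring
  have p6 : squareSum (fun i => z (6 * i)) = nonsquareSum z := by
    change z 6 + z 5 + z 3 = z 3 + z 5 + z 6; ring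
  have t1 : cubicGen (fun i => z (1 * i)) =
    cyclicRatio (z 1 + z 6) (z 3 + z 4) (z 2 + z 5) := rfl
  have t6 : cubicGen (fun i => z (6 * i)) =
      cyclicRatio (z 1 + z 6) (z 3 + z 4) (z 2 + z 5) := by
    rw [add_comm (z 1), add_comm (z 3), add_comm (z 2)]; rfl
  have t3 : cubicGen (fun i => z (3 * i)) =
      cyclicRatio (z 3 + z 4) (z 2 + z 5) (z 1 + z 6) := by
    rw [add_comm (z 1)]; rfl
  have t4 : cubicGen (fun i => z (4 * i)) =
      cyclicRatio (z 3 + z 4) (z 2 + z 5) (z 1 + z 6) := by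
    rw [add_comm (z 3), add_comm (z 2)]; rfl
  have t2 : cubicGen (fun i => z (2 * i)) =
      cyclicRatio (z 2 + z 5) (z 1 + z 6) (z 3 + z 4) := by
    rw [add_comm (z 1), add_comm (z 3)]; rfl
  have t5 : cubicGen (fun i => z (5 * i)) =
      cyclicRatio (z 2 + z 5) (z 1 + z 6) (z 3 + z 4) := by
    rw [add_comm (z 2)]; rfl
  simp only [mul_eq_zero, sub_eq_zero] at hp ht
  rcases hp with hp | hp <;> rcases ht with (ht | ht) | ht
  · exact ⟨1, by decide, by rw [p1, hp], by rw [t1, ht]⟩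
  · exact ⟨4, by decide, by rw [p4, hp], by rw [t4, ht]⟩
  · exact ⟨2, by decide, by rw [p2, hp], by rw [t2, ht]⟩
  · exact ⟨6, by decide, by rw [p6, hp], by rw [t6, ht]⟩
  · exact ⟨3, by decide, by rw [p3, hp], by rw [t3, ht]⟩
  · exact ⟨5, by decide, by rw [p5, hp], by rw [t5, ht]⟩

/-- The images of the `z i` are separable over a field containing the `sexticInvariant`s. -/
theorem mem_separableClosure_of_sexticInvariant {F : Type*} [Field F] [Algebra F M]
    {z : ZMod 7 → L} (hz : IsSexticGeneric z) (φ : L →+* M)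
    (h : ∀ j, φ (sexticInvariant z j) ∈ separableClosure F M) (i : ZMod 7) :
    φ (z i) ∈ separableClosure F M := by
  set S := separableClosure F M
  have hp : φ (squareSum z) ∈ S := by
    refine mem_separableClosure_of_simple_root (X ^ 2 - C ⟨_, h 1⟩ * X + C ⟨_, h 2⟩) ?_ ?_
    · simp only [map_add, map_sub, map_mul, map_pow, aeval_X, aeval_C,
        IntermediateField.algebraMap_apply]
      simp only [← map_add, ← map_sub, ← map_mul, ← map_pow]
      rw [← map_zero φ]
      congr 1
      simp only [sexticInvariant, Matrix.cons_val]
      ring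
    · simp only [derivative_X_pow, derivative_X, derivative_C, derivative_mul, map_sub, map_add,
        map_mul, map_pow, aeval_X, aeval_C, map_one, map_zero, map_natCast,
        IntermediateField.algebraMap_apply]
      have := (map_ne_zero φ).mpr hz.squareSum_sub
      rw [map_sub] at this
      convert this using 1
      simp [sexticInvariant]
      ring
  have ht : φ (cubicGen z) ∈ S := by
    have h3 : φ (sexticInvariant z 3 - 3) ∈ S := by
      rw [map_sub, map_ofNat]
      exact sub_mem (h 3) (ofNat_mem S 3)
    refine mem_separableClosure_of_simple_root
      (X ^ 3 - C ⟨_, h 3⟩ * X ^ 2 + C ⟨_, h3⟩ * X + 1) ?_ ?_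
    · simpa only [map_add, map_sub, map_mul, map_pow, aeval_X, aeval_C, map_one, map_zero,
        IntermediateField.algebraMap_apply] using congrArg φ (cubicGen_root hz)
    · have := (map_ne_zero φ).mpr (cubicGen_simple_root hz)
      simp only [derivative_X_pow, derivative_X, derivative_C, derivative_mul, derivative_one,
        map_sub, map_add, map_mul, map_pow, aeval_X, aeval_C, map_one, map_zero, map_natCast,
        IntermediateField.algebraMap_apply, map_ofNat] at this ⊢
      convert this using 1
      norm_num
  exact mem_of_sexticInvariant_mem (S := S.toSubfield.comap φ) hz h hp ht i

theorem isSexticGeneric_of_algebraicIndependent {k : Type*} [Field k] [Algebra k L]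
    {z : ZMod 7 → L} (hz : AlgebraicIndependent k z) : IsSexticGeneric z := by
  obtain ⟨v, v1, v2, v3, v4, v5, v6⟩ : ∃ v : ZMod 7 → k,
    v 1 = 1 ∧ v 2 = 0 ∧ v 3 = 0 ∧ v 4 = 0 ∧ v 5 = 0 ∧ v 6 = 0 :=
    ⟨(![0, 1, 0, 0, 0, 0, 0] : Fin 7 → k), rfl, rfl, rfl, rfl, rfl, rfl⟩
  obtain ⟨w, w1, w2, w3, w4, w5, w6⟩ : ∃ w : ZMod 7 → k,
    w 1 = 1 ∧ w 2 = 1 ∧ w 3 = 0 ∧ w 4 = 0 ∧ w 5 = 0 ∧ w 6 = 0 :=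
    ⟨(![0, 1, 1, 0, 0, 0, 0] : Fin 7 → k), rfl, rfl, rfl, rfl, rfl, rfl⟩
  let y : ZMod 7 → MvPolynomial (ZMod 7) k := MvPolynomial.X
  have h01 := hz.aeval_ne_zero ((y 1 + y 6) - (y 3 + y 4)) v (by simp [y, *])
  have h12 := hz.aeval_ne_zero ((y 3 + y 4) - (y 2 + y 5)) w (by simp [y, *])
  have h20 := hz.aeval_ne_zero ((y 2 + y 5) - (y 1 + y 6)) v (by simp [y, *])
  have hpq := hz.aeval_ne_zero ((y 1 + y 2 + y 4) - (y 3 + y 5 + y 6)) v (by simp [y, *])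
  have hsq := hz.aeval_ne_zero (((y 1 + y 6) - (y 3 + y 4)) ^ 2 +
    ((y 1 + y 6) - (y 3 + y 4)) * ((y 3 + y 4) - (y 2 + y 5)) + ((y 3 + y 4) - (y 2 + y 5)) ^ 2)
    v (by simp [y, *])
  have hdet := hz.aeval_ne_zero (
    ((y 3 + y 4) - (y 2 + y 5)) ^ 4 * ((y 2 + y 5) - (y 1 + y 6)) ^ 2 +
    ((y 2 + y 5) - (y 1 + y 6)) ^ 4 * ((y 1 + y 6) - (y 3 + y 4)) ^ 2 +
    ((y 1 + y 6) - (y 3 + y 4)) ^ 4 * ((y 3 + y 4) - (y 2 + y 5)) ^ 2 -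
    ((y 1 + y 6) - (y 3 + y 4)) * ((y 3 + y 4) - (y 2 + y 5)) * ((y 2 + y 5) - (y 1 + y 6)) *
    (((y 2 + y 5) - (y 1 + y 6)) ^ 2 * ((y 3 + y 4) - (y 2 + y 5)) +
      ((y 1 + y 6) - (y 3 + y 4)) ^ 2 * ((y 2 + y 5) - (y 1 + y 6)) +
      ((y 3 + y 4) - (y 2 + y 5)) ^ 2 * ((y 1 + y 6) - (y 3 + y 4)))) w (by simp [y, *])
  simp only [y, map_add, map_sub, map_mul, map_pow,
    MvPolynomial.aeval_X] at h01 h12 h20 hpq hsq hdet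
  refine ⟨h01, h12, h20, hpq, ?_, ?_⟩
  · convert div_ne_zero hsq (pow_ne_zero 2 h01) using 1
    unfold cubicGen cyclicRatio
    field_simp
    ring
  · convert div_ne_zero hdet (pow_ne_zero 2 (mul_ne_zero (mul_ne_zero h01 h12) h20)) using 1
    have t01 := cyclicRatio_mul h01 h12
    have t12 := cyclicRatio_mul h12 h20
    have t20 := cyclicRatio_mul h20 h01
    simp only [sexticInvariant, Matrix.cons_val]
    have e : cyclicRatio (z 1 + z 6) (z 3 + z 4) (z 2 + z 5) +
        cyclicRatio (z 3 + z 4) (z 2 + z 5) (z 1 + z 6) +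
        cyclicRatio (z 2 + z 5) (z 1 + z 6) (z 3 + z 4) - 3 =
        cyclicRatio (z 1 + z 6) (z 3 + z 4) (z 2 + z 5) *
          cyclicRatio (z 3 + z 4) (z 2 + z 5) (z 1 + z 6) +
        cyclicRatio (z 3 + z 4) (z 2 + z 5) (z 1 + z 6) *
          cyclicRatio (z 2 + z 5) (z 1 + z 6) (z 3 + z 4) +
        cyclicRatio (z 2 + z 5) (z 1 + z 6) (z 3 + z 4) *
          cyclicRatio (z 1 + z 6) (z 3 + z 4) (z 2 + z 5) := by
      rw [t01, t12, t20]; ring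
    rw [e]
    unfold cyclicRatio
    generalize z 1 + z 6 - (z 3 + z 4) = u at *
    generalize z 3 + z 4 - (z 2 + z 5) = v at *
    generalize z 2 + z 5 - (z 1 + z 6) = w at *
    field_simp

variable {k K : Type*} [Field k] [Field K] [Algebra k K]

theorem det_circulant_ne_zero {x : ZMod 7 → K} (hx : AlgebraicIndependent k x) :
    (Matrix.circulant x).det ≠ 0 := by
  have key (v : ZMod 7 → K) : MvPolynomial.aeval v
      (Matrix.circulant (MvPolynomial.X (R := k) : ZMod 7 → MvPolynomial (ZMod 7) k)).det =
      (Matrix.circulant v).det := by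
    rw [AlgHom.map_det]
    congr 1
    ext i j
    simp
  rw [← key]
  refine hx.aeval_ne_zero _ (Pi.single 0 1 : ZMod 7 → K) ?_
  rw [key, Matrix.circulant_single_one, Matrix.det_one]
  exact one_ne_zero

theorem algebraMap_mem_separableClosure_adjoin {κ : Type*} (s : κ → K) (j : κ) :
    algebraMap K (AlgebraicClosure K) (s j) ∈
      separableClosure (adjoin k (Set.range s)) (AlgebraicClosure K) :=
  IntermediateField.algebraMap_mem (separableClosure (adjoin k (Set.range s)) (AlgebraicClosure K))
    (⟨s j, subset_adjoin k _ (Set.mem_range_self j)⟩ : adjoin k (Set.range s))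

theorem algebraicIndependent_isogeny (h7 : (7 : K) ≠ 0)
    {ψ : AddChar (ZMod 7) (AlgebraicClosure K)} (hψ : ψ.IsPrimitive) {x : ZMod 7 → K}
    (hx : AlgebraicIndependent k x) (hgen : adjoin k (Set.range x) = ⊤) :
    AlgebraicIndependent k (isogeny x) := by
  refine algebraicIndependent_of_isAlgebraic hx
    (isSeparable_adjoin_of_generators hgen fun i => ?_).isAlgebraic
  refine mem_of_isogeny_mem ?_ hψ (det_circulant_ne_zero hx) (algebraMap K _)
    (algebraMap_mem_separableClosure_adjoin _) i
  rw [← map_ofNat (algebraMap K (AlgebraicClosure K)) 7]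
  exact (_root_.map_ne_zero _).mpr h7

theorem isRationalExtension_of_seven_ne_zero (h7 : (7 : K) ≠ 0) (x : ZMod 7 → K)
    (hx : AlgebraicIndependent k x) (hgen : adjoin k (Set.range x) = ⊤) (σ τ : K ≃ₐ[k] K)
    (hσ : ∀ i, σ (x i) = x (i + 1)) (hτ : ∀ i, τ (x i) = x (3 * i)) :
    IsRationalExtension k (fixedField (Subgroup.closure {σ, τ})) := by
  have h10 : (1 : ZMod 7) ≠ 0 := by decide
  have h30 : (3 : ZMod 7) ≠ 0 := by decide
  let ι := algebraMap K (AlgebraicClosure K)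
  have h7' : (7 : AlgebraicClosure K) ≠ 0 := by
    rw [← map_ofNat (algebraMap K (AlgebraicClosure K)) 7]
    exact (_root_.map_ne_zero _).mpr h7
  have : NeZero ((7 : ℕ) : AlgebraicClosure K) := ⟨by simpa using h7'⟩
  obtain ⟨ζ, hζ⟩ := HasEnoughRootsOfUnity.exists_primitiveRoot (AlgebraicClosure K) 7
  have hψ := AddChar.zmodChar_primitive_of_primitive_root 7 hζ
  have hdet := det_circulant_ne_zero hx
  have hz := isSexticGeneric_of_algebraicIndependent (algebraicIndependent_isogeny h7 hψ hx hgen)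
  have hfix {g : K ≃ₐ[k] K} {a d : ZMod 7} (ha : a ≠ 0) (hg : ∀ i, g (x i) = x (a * i + d)) :
      (∀ i, g (isogeny x i) = isogeny x (a * i)) ∧
        ∀ j, g (sexticInvariant (isogeny x) j) = sexticInvariant (isogeny x) j := by
    have h1 := isogeny_map (g := (g : K →+* K)) h7' hψ ι hdet ha hg
    refine ⟨h1, fun j => ?_⟩
    refine (map_sexticInvariant (g : K →+* K) _ j).trans ?_
    rw [← sexticInvariant_mul (isogeny x) ha]
    congr 1
    exact funext h1
  refine isRationalExtension_fixedField (s := (sexticInvariant (isogeny x) : Fin 7 → K)) hx hgen _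
    ?_ ?_ ?_
  · rintro g (rfl | rfl) j
    · exact (hfix h10 fun i => by rw [hσ, one_mul]).2 j
    · exact (hfix (d := 0) h30 fun i => by rw [hτ, add_zero]).2 j
  · refine mem_of_isogeny_mem h7' hψ hdet ι
      (mem_separableClosure_of_sexticInvariant hz ι
        (algebraMap_mem_separableClosure_adjoin (k := k) (sexticInvariant (isogeny x))))
  · intro φ hφ
    obtain ⟨a, ha, hp, ht⟩ := exists_mul_of_sexticInvariant hz ι (φ : K →+* AlgebraicClosure K) hφ
    obtain ⟨g, -, hg⟩ := exists_mem_closure_affine hσ hτ ha 0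
    obtain ⟨hgz, hgs⟩ := hfix ha hg
    have hφz (i) : φ (isogeny x i) = ι (isogeny x (a * i)) := by
      have := mem_of_sexticInvariant_mem
        (S := RingHom.eqLocusField (φ : K →+* AlgebraicClosure K) (ι.comp (g : K →+* K))) hz
        (fun j => (hφ j).trans (congrArg ι (hgs j)).symm)
        (hp.trans (congrArg ι (by simp [squareSum, hgz])))
        (ht.trans (congrArg ι (by simp [cubicGen, cyclicRatio, hgz]))) i
      exact this.trans (congrArg ι (hgz i))
    obtain ⟨d, hd⟩ := exists_translate_of_isogeny hζ h7' hdet ι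
      (φ : K →+* AlgebraicClosure K) ha hφz
    obtain ⟨g', hg', hgx⟩ := exists_mem_closure_affine hσ hτ ha d
    exact ⟨g', hg', fun i => (hd i).trans (congrArg ι (hgx i)).symm⟩

end

end

/-- The fixed field of `G₄₂ = ⟨σ, τ⟩` with `σ : xᵢ ↦ x_{i+1}`, `τ : xᵢ ↦ x_{3i}` (indices mod 7) acting on the rational function field in 7 variables is purely transcendental over any field `k`. -/
theorem G42_fixed_field_rational
    (k K : Type*) [Field k] [Field K] [Algebra k K]
    (x : ZMod 7 → K) (hx : AlgebraicIndependent k x)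
    (hgen : IntermediateField.adjoin k (Set.range x) = ⊤)
    (σ τ : K ≃ₐ[k] K)
    (hσ : ∀ i : ZMod 7, σ (x i) = x (i + 1))
    (hτ : ∀ i : ZMod 7, τ (x i) = x (3 * i)) :
    IsRationalExtension k
      (IntermediateField.fixedField (Subgroup.closure {σ, τ})) := by
  by_cases h7 : (7 : K) = 0
  · have : CharP K 7 := (CharP.charP_iff_prime_eq_zero (by norm_num)).mpr (by simpa using h7)
    exact isRationalExtension_of_char_seven x hx hgen σ τ hσ hτ
  · exact isRationalExtension_of_seven_ne_zero h7 x hx hgen σ τ hσ hτ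
end

section
/- Let k be any field and let D₇ = ⟨σ, ρ⟩ act on the rational function field k(x₀,...,x₆) by σ: xᵢ ↦ x_{i+1 mod 7} and ρ: xᵢ ↦ x_{−i mod 7}. Then k(x₀,...,x₆)^{D₇} is purely transcendental over k. -/
open IntermediateField Module

section
variable {k K : Type*} [Field k] [Field K] [Algebra k K]

/-- A subextension of a simple extension generated by a root of a monic polynomial of degree `n` is
finite of degree at most `n`. -/
theorem finite_and_finrank_le_of_le_adjoin_simple {a : K} {p : Polynomial k}
    (hp : p.Monic) (ha : Polynomial.aeval a p = 0) {E : IntermediateField k K} (hE : E ≤ k⟮a⟯) :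
    FiniteDimensional k E ∧ finrank k E ≤ p.natDegree := by
  have hint : IsIntegral k a := ⟨p, hp, ha⟩
  have : FiniteDimensional k k⟮a⟯ := adjoin.finiteDimensional hint
  refine ⟨.of_injective (inclusion hE).toLinearMap (inclusion hE).injective,
    (LinearMap.finrank_le_finrank_of_injective (f := (inclusion hE).toLinearMap)
      (inclusion hE).injective).trans ?_⟩
  rw [adjoin.finrank hint]
  exact Polynomial.natDegree_le_natDegree (minpoly.min k a hp ha)

theorem finite_and_finrank_le_of_adjoin_simple_eq_top {a : K} {p : Polynomial k}
    (hp : p.Monic) (ha : Polynomial.aeval a p = 0) (htop : k⟮a⟯ = ⊤) :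
    FiniteDimensional k K ∧ finrank k K ≤ p.natDegree := by
  obtain ⟨hfin, hle⟩ := finite_and_finrank_le_of_le_adjoin_simple hp ha (E := ⊤) htop.ge
  exact ⟨topEquiv.toLinearEquiv.finiteDimensional, by rwa [finrank_top'] at hle⟩

/-- The base field is algebraically closed in a purely transcendental extension. -/
theorem AlgebraicIndependent.mem_range_algebraMap_of_isAlgebraic {ι : Type*} {x : ι → K}
    (hx : AlgebraicIndependent k x) {c : K} (hc : IsAlgebraic k c)
    (hcx : c ∈ adjoin k (Set.range x)) : c ∈ Set.range (algebraMap k K) := by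
  obtain ⟨r, s, hrs⟩ := (mem_adjoin_range_iff k x c).1 hcx
  by_cases hs : s = 0
  · exact ⟨0, by simp [hrs, hs]⟩
  have hs' : MvPolynomial.aeval x s ≠ 0 := fun h ↦ hs (hx.eq_zero_of_aeval_eq_zero s h)
  let d : algebraicClosure k K := ⟨c, mem_algebraicClosure_iff.2 hc⟩
  have hC := hx.algebraicClosure
  have key : MvPolynomial.C d * MvPolynomial.map (algebraMap k (algebraicClosure k K)) s -
      MvPolynomial.map (algebraMap k (algebraicClosure k K)) r = 0 := by
    refine hC.eq_zero_of_aeval_eq_zero _ ?_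
    have hd : algebraMap (algebraicClosure k K) K d = c := rfl
    simp only [map_sub, map_mul, MvPolynomial.aeval_C, MvPolynomial.aeval_map_algebraMap, hd]
    rw [hrs, div_mul_cancel₀ _ hs', sub_self]
  obtain ⟨m, hm⟩ := MvPolynomial.ne_zero_iff.1 hs
  have hcoeff := congrArg (fun q ↦ algebraMap (algebraicClosure k K) K (MvPolynomial.coeff m q)) key
  simp only [MvPolynomial.coeff_sub, MvPolynomial.coeff_C_mul, MvPolynomial.coeff_map, map_sub,
    map_mul, ← IsScalarTower.algebraMap_apply, MvPolynomial.coeff_zero, map_zero] at hcoeff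
  refine ⟨r.coeff m / s.coeff m, ?_⟩
  rw [map_div₀, div_eq_iff (by simpa using hm)]
  exact (sub_eq_zero.1 hcoeff).symm

theorem isAlgebraic_algebraAdjoin_of_isAlgebraic (s : Set K)
    [Algebra.IsAlgebraic (adjoin k s) K] : Algebra.IsAlgebraic (Algebra.adjoin k s) K := by
  open scoped IntermediateField.algebraAdjoinAdjoin in
  exact (IsFractionRing.comap_isAlgebraic_iff (K := adjoin k s)).2 inferInstance

theorem AlgebraicIndependent.of_finite_adjoin {ι : Type*} [Finite ι] {x g : ι → K}
    (hx : AlgebraicIndependent k x) (hgen : adjoin k (Set.range x) = ⊤)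
    [FiniteDimensional (adjoin k (Set.range g)) K] : AlgebraicIndependent k g := by
  have htop : Algebra.IsAlgebraic (adjoin k (Set.range x)) K := by
    rw [hgen]
    exact ⟨fun a ↦ isAlgebraic_algebraMap (⟨a, mem_top⟩ : (⊤ : IntermediateField k K))⟩
  have hxalg := isAlgebraic_algebraAdjoin_of_isAlgebraic (k := k) (Set.range x)
  have := isAlgebraic_algebraAdjoin_of_isAlgebraic (k := k) (Set.range g)
  have hbasis : IsTranscendenceBasis k x := hx.isTranscendenceBasis_iff_isAlgebraic.2 hxalg
  exact (Algebra.IsAlgebraic.isTranscendenceBasis_of_lift_le_trdeg_of_finite k g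
    hbasis.lift_cardinalMk_eq_trdeg.le).1

theorem eq_top_of_range_subset {ι : Type*} {x : ι → K} (hgen : adjoin k (Set.range x) = ⊤)
    {S : IntermediateField k K} (h : ∀ i, x i ∈ S) : S = ⊤ :=
  top_le_iff.1 (hgen ▸ adjoin_le_iff.2 (Set.range_subset_iff.2 h))

theorem fixedField_eq_of_dvd_card {G : Subgroup (K ≃ₐ[k] K)} {F : IntermediateField k K}
    [FiniteDimensional F K] (hFG : F ≤ fixedField G) {n : ℕ} (hn : finrank F K ≤ n)
    (hcard : n ∣ Nat.card G) : fixedField G = F := by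
  have : Finite F.fixingSubgroup := Finite.of_equiv _ (fixingSubgroupEquiv F).toEquiv.symm
  have : Finite G := Finite.of_injective _ (Subgroup.inclusion_injective ((le_iff_le _ _).1 hFG))
  have : Fintype G := Fintype.ofFinite G
  refine (eq_of_le_of_finrank_le' hFG
    ((hn.trans (Nat.le_of_dvd Nat.card_pos hcard)).trans_eq ?_)).symm
  rw [Nat.card_eq_fintype_card]
  exact (FixedPoints.finrank_eq_card G K).symm

theorem mul_orderOf_dvd_card_closure_pair {G : Type*} [Group G] {a b : G}
    (h : (orderOf a).Coprime (orderOf b)) :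
    orderOf a * orderOf b ∣ Nat.card (Subgroup.closure {a, b}) :=
  h.mul_dvd_of_dvd_of_dvd
    (Subgroup.orderOf_dvd_natCard _ (Subgroup.subset_closure (by simp)))
    (Subgroup.orderOf_dvd_natCard _ (Subgroup.subset_closure (by simp)))

theorem algEquiv_pow_apply {ι : Type*} {φ : K ≃ₐ[k] K} {x : ι → K} {f : ι → ι}
    (h : ∀ i, φ (x i) = x (f i)) (n : ℕ) (i : ι) : (φ ^ n) (x i) = x (f^[n] i) := by
  induction n generalizing i with
  | zero => simp
  | succ n ih => rw [pow_succ, AlgEquiv.mul_apply, h, ih, Function.iterate_succ_apply]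

theorem mem_fixedField_zpowers_iff {φ : K ≃ₐ[k] K} {a : K} :
    a ∈ fixedField (Subgroup.zpowers φ) ↔ φ a = a := by
  refine ⟨fun ha ↦ ha ⟨φ, Subgroup.mem_zpowers φ⟩, fun ha ↦ ?_⟩
  rintro ⟨ψ, hψ⟩
  have h : φ ∈ MulAction.stabilizer (K ≃ₐ[k] K) a := ha
  exact Subgroup.zpowers_le.2 h hψ

theorem algEquiv_eq_one_of_fixes_generators {ι : Type*} {x : ι → K}
    (hgen : adjoin k (Set.range x) = ⊤) {φ : K ≃ₐ[k] K} (h : ∀ i, φ (x i) = x i) : φ = 1 := by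
  have htop := eq_top_of_range_subset hgen fun i ↦ mem_fixedField_zpowers_iff.2 (h i)
  ext a
  exact mem_fixedField_zpowers_iff.1 (htop ▸ mem_top)

theorem orderOf_eq_prime_of_permutes {ι : Type*} {x : ι → K} (hx : Function.Injective x)
    (hgen : adjoin k (Set.range x) = ⊤) {φ : K ≃ₐ[k] K} {f : ι → ι}
    (h : ∀ i, φ (x i) = x (f i)) {p : ℕ} [Fact p.Prime] (hp : ∀ i, f^[p] i = i)
    {i : ι} (hi : f i ≠ i) : orderOf φ = p := by
  refine orderOf_eq_prime (algEquiv_eq_one_of_fixes_generators hgen fun j ↦ ?_) ?_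
  · rw [algEquiv_pow_apply h, hp]
  · rintro rfl
    exact hi (hx (h i)).symm

theorem fourteen_dvd_card_closure {x : ZMod 7 → K} (hx : Function.Injective x)
    (hgen : adjoin k (Set.range x) = ⊤) {σ τ : K ≃ₐ[k] K}
    (hσ : ∀ i, σ (x i) = x (i + 1)) (hτ : ∀ i, τ (x i) = x (-i)) :
    14 ∣ Nat.card (Subgroup.closure {σ, τ}) := by
  have h01 : (0 : ZMod 7) + 1 ≠ 0 := by decide
  have h1 : -(1 : ZMod 7) ≠ 1 := by decide
  have : Fact (Nat.Prime 7) := ⟨by norm_num⟩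
  have h7 : orderOf σ = 7 := orderOf_eq_prime_of_permutes hx hgen hσ (by decide) h01
  have h2 : orderOf τ = 2 := orderOf_eq_prime_of_permutes hx hgen hτ (by decide) h1
  simpa [h7, h2] using
    mul_orderOf_dvd_card_closure_pair (a := σ) (b := τ) (by rw [h7, h2]; norm_num)

/-- Seven `σ`-invariants permuted by `τ` as the variables are, and over which `K` has degree at
most 7, yield rationality of the fixed field of the dihedral group. -/
theorem isRationalExtension_of_invariants {x : ZMod 7 → K} (hx : AlgebraicIndependent k x)
    (hgen : adjoin k (Set.range x) = ⊤) {σ τ : K ≃ₐ[k] K}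
    (hσ : ∀ i, σ (x i) = x (i + 1)) (hτ : ∀ i, τ (x i) = x (-i))
    {z : ZMod 7 → K} (hzσ : ∀ i, σ (z i) = z i) (hzτ : ∀ i, τ (z i) = z (-i))
    [FiniteDimensional (adjoin k (Set.range z)) K]
    (hdeg : finrank (adjoin k (Set.range z)) K ≤ 7) :
    IsRationalExtension k (fixedField (Subgroup.closure {σ, τ})) := by
  have hz := hx.of_finite_adjoin hgen (g := z)
  have hz16 : z 1 - z 6 ≠ 0 := sub_ne_zero.2 fun h ↦ absurd (hz.injective h) (by decide)
  let g : Fin 7 → K := ![z 0, z 1 + z 6, z 1 * z 6, z 2 + z 5, z 1 * z 2 + z 6 * z 5,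
    z 3 + z 4, z 1 * z 3 + z 6 * z 4]
  set F := adjoin k (Set.range g)
  set E := adjoin k (Set.range z)
  have hgF : ∀ i, g i ∈ F := fun i ↦ subset_adjoin _ _ ⟨i, rfl⟩
  have hzE : ∀ i, z i ∈ E := fun i ↦ subset_adjoin _ _ ⟨i, rfl⟩
  have hFE : F ≤ E := adjoin_le_iff.2 <| Set.range_subset_iff.2 fun i ↦ by
    fin_cases i
    · exact hzE 0
    · exact add_mem (hzE 1) (hzE 6)
    · exact mul_mem (hzE 1) (hzE 6)
    · exact add_mem (hzE 2) (hzE 5)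
    · exact add_mem (mul_mem (hzE 1) (hzE 2)) (mul_mem (hzE 6) (hzE 5))
    · exact add_mem (hzE 3) (hzE 4)
    · exact add_mem (mul_mem (hzE 1) (hzE 3)) (mul_mem (hzE 6) (hzE 4))
  -- `E` is generated over `F` by `z 1`, a root of a quadratic polynomial.
  have key : FiniteDimensional F (extendScalars hFE) ∧ finrank F (extendScalars hFE) ≤ 2 := by
    let p : Polynomial F := Polynomial.X ^ 2 - Polynomial.C ⟨g 1, hgF 1⟩ * Polynomial.X +
      Polynomial.C ⟨g 2, hgF 2⟩
    have hp : p.natDegree = 2 := by simp only [p]; compute_degree!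
    have hpm : p.Monic := by simp only [p]; monicity!
    rw [← hp]
    refine finite_and_finrank_le_of_le_adjoin_simple hpm (a := z 1) ?_ ?_
    · simp only [p, map_add, map_sub, map_mul, map_pow, Polynomial.aeval_X, Polynomial.aeval_C,
        IntermediateField.algebraMap_apply]
      simp only [g, Matrix.cons_val]
      ring
    · have hgS (i : Fin 7) : g i ∈ F⟮z 1⟯ :=
        IntermediateField.algebraMap_mem F⟮z 1⟯ (⟨g i, hgF i⟩ : F)
      have h1 : z 1 ∈ F⟮z 1⟯ := mem_adjoin_simple_self F (z 1)
      have h6 : z 6 ∈ F⟮z 1⟯ := by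
        convert sub_mem (hgS 1) h1 using 1
        simp [g]
      have hswap {u v : K} (hadd : u + v ∈ F⟮z 1⟯) (hmul : z 1 * u + z 6 * v ∈ F⟮z 1⟯) :
          u ∈ F⟮z 1⟯ ∧ v ∈ F⟮z 1⟯ := by
        have hu : u ∈ F⟮z 1⟯ := by
          convert div_mem (sub_mem hmul (mul_mem h6 hadd)) (sub_mem h1 h6) using 1
          field_simp
          ring
        exact ⟨hu, by simpa using sub_mem hadd hu⟩
      obtain ⟨h2, h5⟩ := hswap (hgS 3) (hgS 4)
      obtain ⟨h3, h4⟩ := hswap (hgS 5) (hgS 6)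
      rw [extendScalars_le_iff, adjoin_le_iff, Set.range_subset_iff]
      intro i
      fin_cases i
      exacts [hgS 0, h1, h2, h3, h4, h5, h6]
  obtain ⟨hfin, h2⟩ := key
  have hfin' : FiniteDimensional (extendScalars hFE) K := ‹FiniteDimensional E K›
  have : FiniteDimensional F K := .trans F (extendScalars hFE) K
  have hF14 : finrank F K ≤ 14 := by
    rw [← finrank_mul_finrank F (extendScalars hFE) K]
    exact Nat.mul_le_mul h2 hdeg
  have hfix : F ≤ fixedField (Subgroup.closure {σ, τ}) := by
    have hmem {φ : K ≃ₐ[k] K} (hφ : ∀ i, φ (g i) = g i) : φ ∈ F.fixingSubgroup := by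
      refine (le_iff_le _ _).1 (adjoin_le_iff.2 ?_) (Subgroup.mem_zpowers φ)
      exact Set.range_subset_iff.2 fun i ↦ mem_fixedField_zpowers_iff.2 (hφ i)
    rw [le_iff_le, Subgroup.closure_le, Set.insert_subset_iff, Set.singleton_subset_iff]
    have hneg : (-0 : ZMod 7) = 0 ∧ (-1 : ZMod 7) = 6 ∧ (-2 : ZMod 7) = 5 ∧ (-3 : ZMod 7) = 4 ∧
      (-4 : ZMod 7) = 3 ∧ (-5 : ZMod 7) = 2 ∧ (-6 : ZMod 7) = 1 := by decide
    refine ⟨hmem fun i ↦ ?_, hmem fun i ↦ ?_⟩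
    · fin_cases i <;> simp [g, hzσ]
    · fin_cases i <;> simp [g, hzτ, hneg] <;> ring
  rw [fixedField_eq_of_dvd_card hfix hF14 (fourteen_dvd_card_closure hx.injective hgen hσ hτ)]
  exact ⟨Set.range g, (hx.of_finite_adjoin hgen (g := g)).to_subtype_range, rfl⟩

/-- The `d`-th moment about `s` of a family indexed by `ZMod 7`. -/
def centralMoment [CharP K 7] (x : ZMod 7 → K) (s : K) (d : ℕ) : K :=
  ∑ i, (ZMod.castHom dvd_rfl K i - s) ^ d * x i

section CharSeven
variable [CharP K 7]

theorem map_centralMoment_of_shift {x : ZMod 7 → K} {σ : K ≃ₐ[k] K}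
    (hσ : ∀ i, σ (x i) = x (i + 1)) {s t : K} (hs : σ s = t - 1) (d : ℕ) :
    σ (centralMoment x s d) = centralMoment x t d := by
  have hc (i : ZMod 7) : σ (ZMod.castHom dvd_rfl K i) = ZMod.castHom dvd_rfl K i :=
    DFunLike.congr_fun (RingHom.ext_zmod ((σ : K →+* K).comp (ZMod.castHom dvd_rfl K))
      (ZMod.castHom dvd_rfl K)) i
  simp only [centralMoment, map_sum, map_mul, map_pow, map_sub, hc, hσ, hs]
  refine Fintype.sum_equiv (Equiv.addRight 1) _ _ fun i ↦ ?_
  rw [Equiv.coe_addRight, map_add, map_one]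
  ring

theorem map_centralMoment_of_neg {x : ZMod 7 → K} {τ : K ≃ₐ[k] K}
    (hτ : ∀ i, τ (x i) = x (-i)) {s t : K} (hs : τ s = -t) (d : ℕ) :
    τ (centralMoment x s d) = (-1) ^ d * centralMoment x t d := by
  have hc (i : ZMod 7) : τ (ZMod.castHom dvd_rfl K i) = ZMod.castHom dvd_rfl K i :=
    DFunLike.congr_fun (RingHom.ext_zmod ((τ : K →+* K).comp (ZMod.castHom dvd_rfl K))
      (ZMod.castHom dvd_rfl K)) i
  simp only [centralMoment, map_sum, map_mul, map_pow, map_sub, hc, hτ, hs, Finset.mul_sum]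
  refine Fintype.sum_equiv (Equiv.neg _) _ _ fun i ↦ ?_
  rw [Equiv.neg_apply, map_neg, ← mul_assoc, ← mul_pow]
  ring

/-- A family indexed by `ZMod 7` is recovered from its moments of order at most six. -/
theorem apply_eq_sub_sum_centralMoment (x : ZMod 7 → K) (s : K) (i : ZMod 7) :
    x i = centralMoment x s 0 - ∑ m ∈ Finset.range 7,
      centralMoment x s m * ((s - ZMod.castHom dvd_rfl K i) ^ (6 - m) * (Nat.choose 6 m : K)) := by
  have hdelta : ∀ i j : ZMod 7, 1 - (j - i) ^ 6 = if j = i then 1 else 0 := by decide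
  have hdelta' (j : ZMod 7) : 1 - (ZMod.castHom dvd_rfl K j - ZMod.castHom dvd_rfl K i) ^ 6 =
      if j = i then 1 else 0 := by
    have := congrArg (ZMod.castHom dvd_rfl K) (hdelta i j)
    rw [map_sub, map_one, map_pow, map_sub] at this
    rw [this]
    split_ifs <;> simp
  have hsum (j : ZMod 7) : (ZMod.castHom dvd_rfl K j - ZMod.castHom dvd_rfl K i) ^ 6 =
      ∑ m ∈ Finset.range 7, (ZMod.castHom dvd_rfl K j - s) ^ m *
        ((s - ZMod.castHom dvd_rfl K i) ^ (6 - m) * (Nat.choose 6 m : K)) := by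
    rw [← sub_add_sub_cancel _ s, add_pow]
    simp only [mul_assoc]
  calc x i = ∑ j, (1 - (ZMod.castHom dvd_rfl K j - ZMod.castHom dvd_rfl K i) ^ 6) * x j := by
        simp only [hdelta', ite_mul, one_mul, zero_mul, Finset.sum_ite_eq', Finset.mem_univ, if_true]
    _ = _ := by
        simp only [sub_mul, Finset.sum_sub_distrib, hsum, centralMoment, Finset.sum_mul, pow_zero]
        rw [Finset.sum_comm (s := Finset.univ)]
        simp only [mul_right_comm]

theorem exists_invariants_of_charP_seven {x : ZMod 7 → K} (hx : AlgebraicIndependent k x)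
    (hgen : adjoin k (Set.range x) = ⊤) {σ τ : K ≃ₐ[k] K}
    (hσ : ∀ i, σ (x i) = x (i + 1)) (hτ : ∀ i, τ (x i) = x (-i)) :
    ∃ z : ZMod 7 → K, (∀ i, σ (z i) = z i) ∧ (∀ i, τ (z i) = z (-i)) ∧
      FiniteDimensional (adjoin k (Set.range z)) K ∧
      finrank (adjoin k (Set.range z)) K ≤ 7 := by
  have h27 : (2 : ZMod 7) ≠ 0 := by decide
  have : Fact (Nat.Prime 7) := ⟨by norm_num⟩
  let c := ZMod.castHom (dvd_refl 7) K
  have h2 : (2 : K) ≠ 0 := by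
    have : c 2 ≠ 0 := (map_ne_zero c).2 h27
    simpa only [map_ofNat] using this
  have hw0 : ∑ i, x i ≠ 0 := by
    intro h
    have := Fintype.linearIndependent_iff.1 hx.linearIndependent (fun _ ↦ 1) (by simpa using h) 0
    exact one_ne_zero this
  set s : K := (∑ i, c i * x i) / ∑ i, x i with hs
  have hσc (i : ZMod 7) : σ (c i) = c i :=
    DFunLike.congr_fun (RingHom.ext_zmod ((σ : K →+* K).comp c) c) i
  have hτc (i : ZMod 7) : τ (c i) = c i :=
    DFunLike.congr_fun (RingHom.ext_zmod ((τ : K →+* K).comp c) c) i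
  have hm1 : centralMoment x s 1 = 0 := by
    simp only [centralMoment, pow_one, sub_mul, Finset.sum_sub_distrib, ← Finset.mul_sum]
    rw [hs, div_mul_cancel₀ _ hw0, sub_self]
  have hσ0 : σ (∑ i, x i) = ∑ i, x i := by
    simpa [hσ] using Fintype.sum_equiv (Equiv.addRight (1 : ZMod 7)) _ x fun _ ↦ rfl
  have hτ0 : τ (∑ i, x i) = ∑ i, x i := by
    simpa [hτ] using Fintype.sum_equiv (Equiv.neg (ZMod 7)) _ x fun _ ↦ rfl
  have hσs : σ s = s - 1 := by
    rw [hs, map_div₀, hσ0, eq_sub_iff_add_eq, div_add_one hw0]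
    congr 1
    rw [← hσ0]
    simp only [map_sum, map_mul, hσc, hσ, ← Finset.sum_add_distrib]
    refine Fintype.sum_equiv (Equiv.addRight 1) _ _ fun i ↦ ?_
    rw [Equiv.coe_addRight, map_add, map_one]
    ring
  have hτs : τ s = -s := by
    rw [hs, map_div₀, hτ0, ← neg_div]
    congr 1
    simp only [map_sum, map_mul, hτc, hτ, ← Finset.sum_neg_distrib]
    refine Fintype.sum_equiv (Equiv.neg _) _ _ fun i ↦ ?_
    simp
  have hσw := map_centralMoment_of_shift hσ hσs
  have hτw := map_centralMoment_of_neg hτ hτs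
  set w := centralMoment x s
  set p := s ^ 7 - s with hp
  have hfr : (s - 1) ^ 7 = s ^ 7 - 1 := by
    simpa using sub_pow_char s 1 (p := 7)
  have hσp : σ p = p := by rw [hp, map_sub, map_pow, hσs, hfr]; ring
  have hτp : τ p = -p := by rw [hp, map_sub, map_pow, hτs]; ring
  let z : ZMod 7 → K := ![w 0, w 2 + w 3, w 4 + w 5, w 6 + p, w 6 - p, w 4 - w 5, w 2 - w 3]
  set F := adjoin k (Set.range z)
  have hz : ∀ i, z i ∈ F := fun i ↦ subset_adjoin _ _ ⟨i, rfl⟩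
  have hhalf {a b : K} (h₁ : a + b ∈ F) (h₂ : a - b ∈ F) : a ∈ F ∧ b ∈ F := by
    have h2F : (2 : K) ∈ F := ofNat_mem F 2
    constructor
    · convert div_mem (add_mem h₁ h₂) h2F using 1
      field_simp
      ring
    · convert div_mem (sub_mem h₁ h₂) h2F using 1
      field_simp
      ring
  obtain ⟨hw2, hw3⟩ := hhalf (hz 1) (hz 6)
  obtain ⟨hw4, hw5⟩ := hhalf (hz 2) (hz 5)
  obtain ⟨hw6, hpF⟩ := hhalf (hz 3) (hz 4)
  have hwF : ∀ m < 7, w m ∈ F := by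
    intro m hm
    interval_cases m
    exacts [hz 0, hm1 ▸ zero_mem F, hw2, hw3, hw4, hw5, hw6]
  have hfin : FiniteDimensional F K ∧ finrank F K ≤ 7 := by
    let P : Polynomial F := Polynomial.X ^ 7 - Polynomial.X - Polynomial.C ⟨p, hpF⟩
    have hP : P.natDegree = 7 := by simp only [P]; compute_degree!
    have hPm : P.Monic := by simp only [P]; monicity!
    rw [← hP]
    refine finite_and_finrank_le_of_adjoin_simple_eq_top hPm (a := s) ?_ ?_
    · simp [P, hp]
    · refine restrictScalars_injective k ?_
      refine (eq_top_of_range_subset hgen fun i ↦ ?_).trans restrictScalars_top.symm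
      rw [mem_restrictScalars, apply_eq_sub_sum_centralMoment x s i]
      have hsF : s ∈ F⟮s⟯ := mem_adjoin_simple_self F s
      have hwF' (m : ℕ) (hm : m < 7) : w m ∈ F⟮s⟯ :=
        IntermediateField.algebraMap_mem F⟮s⟯ (⟨w m, hwF m hm⟩ : F)
      have hcF : c i ∈ F⟮s⟯ := by
        rw [← ZMod.natCast_zmod_val i, map_natCast]
        exact _root_.natCast_mem _ _
      refine sub_mem (hwF' 0 (by norm_num)) (sum_mem fun m hm ↦ ?_)
      exact mul_mem (hwF' m (Finset.mem_range.1 hm))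
        (mul_mem (pow_mem (sub_mem hsF hcF) _) (_root_.natCast_mem _ _))
  refine ⟨z, fun i ↦ ?_, fun i ↦ ?_, hfin⟩
  · fin_cases i <;> simp [z, hσw, hσp]
  · fin_cases i
    exacts [show τ (w 0) = w 0 by simp [hτw],
      show τ (w 2 + w 3) = w 2 - w 3 by simp [hτw]; ring,
      show τ (w 4 + w 5) = w 4 - w 5 by simp [hτw]; ring,
      show τ (w 6 + p) = w 6 - p by simp [hτw, hτp]; ring,
      show τ (w 6 - p) = w 6 + p by simp [hτw, hτp]; ring,
      show τ (w 4 - w 5) = w 4 + w 5 by simp [hτw]; ring,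
      show τ (w 2 - w 3) = w 2 + w 3 by simp [hτw]; ring]
end CharSeven

end

section
variable {Ω Ω' : Type*} [Field Ω] [Field Ω']

theorem AddChar.IsPrimitive.exists_mulShift_eq {p : ℕ} [Fact p.Prime] {ψ φ : AddChar (ZMod p) Ω}
    (hψ : ψ.IsPrimitive) (hφ : φ.IsPrimitive) : ∃ c, c ≠ 0 ∧ φ = ψ.mulShift c := by
  have hpow (χ : AddChar (ZMod p) Ω) (n : ℕ) : χ 1 ^ n = χ n := by
    rw [← AddChar.map_nsmul_eq_pow, nsmul_one]
  have h1 : ψ 1 ≠ 1 := (AddChar.zmod_char_ne_one_iff p ψ).1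
    (by simpa using hψ one_ne_zero)
  have hroot : IsPrimitiveRoot (ψ 1) p :=
    IsPrimitiveRoot.iff_orderOf.2 (orderOf_eq_prime (by simp [hpow]) h1)
  obtain ⟨n, -, hn⟩ := hroot.eq_pow_of_pow_eq_one (ξ := φ 1) (by simp [hpow])
  have heq : φ = ψ.mulShift (n : ZMod p) := by
    ext a
    obtain ⟨m, rfl⟩ := ZMod.natCast_zmod_surjective a
    rw [← hpow, ← hn, hpow, ← AddChar.map_nsmul_eq_pow, AddChar.mulShift_apply, nsmul_eq_mul,
      mul_comm]
  refine ⟨n, fun h ↦ hφ one_ne_zero ?_, heq⟩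
  rw [heq, h, AddChar.mulShift_zero, AddChar.mulShift_one]

/-- The Fourier transform of a family indexed by `ZMod n`. -/
def fourierSum {n : ℕ} [NeZero n] (ψ : AddChar (ZMod n) Ω) (u : ZMod n → Ω) (a : ZMod n) : Ω :=
  ∑ l, ψ (a * l) * u l

section
variable {n : ℕ} [NeZero n] (ψ : AddChar (ZMod n) Ω) (u : ZMod n → Ω)

theorem fourierSum_mulShift (c a : ZMod n) :
    fourierSum (ψ.mulShift c) u a = fourierSum ψ u (c * a) := by
  simp [fourierSum, AddChar.mulShift_apply, mul_assoc]

theorem fourierSum_shift (c a : ZMod n) :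
    fourierSum ψ (fun i ↦ u (i + c)) a = ψ (-(a * c)) * fourierSum ψ u a := by
  rw [fourierSum, fourierSum, Finset.mul_sum]
  refine Fintype.sum_equiv (Equiv.addRight c) _ _ fun i ↦ ?_
  rw [Equiv.coe_addRight, ← mul_assoc, ← AddChar.map_add_eq_mul]
  ring_nf

theorem fourierSum_comp_unit {c : ZMod n} (hc : IsUnit c) (a : ZMod n) :
    fourierSum ψ (fun i ↦ u (c * i)) (c * a) = fourierSum ψ u a := by
  refine Fintype.sum_bijective (c * ·) (IsUnit.isUnit_iff_mulLeft_bijective.1 hc) _ _ fun i ↦ ?_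
  ring_nf

theorem map_fourierSum (f : Ω →+* Ω') (a : ZMod n) :
    f (fourierSum ψ u a) =
      fourierSum ((f : Ω →* Ω').compAddChar ψ) (f ∘ u) a := by
  simp [fourierSum]

theorem fourierSum_fourierSum {ψ : AddChar (ZMod n) Ω} (hψ : ψ.IsPrimitive) (a : ZMod n) :
    fourierSum ψ (fourierSum ψ u) a = n * u (-a) := by
  have h (m : ZMod n) : ∑ l, ψ (a * l) * (ψ (l * m) * u m) = if m = -a then n * u m else 0 := by
    have := AddChar.sum_mulShift (a + m) hψ
    simp only [ZMod.card, add_eq_zero_iff_eq_neg', mul_add, AddChar.map_add_eq_mul] at this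
    simp only [← mul_assoc, ← Finset.sum_mul, mul_comm a, this, Nat.cast_ite, ite_mul,
      Nat.cast_zero, zero_mul]
  calc fourierSum ψ (fourierSum ψ u) a = ∑ l, ∑ m, ψ (a * l) * (ψ (l * m) * u m) := by
        simp only [fourierSum, Finset.mul_sum]
    _ = n * u (-a) := by rw [Finset.sum_comm]; simp [h]

theorem fourierSum_mem {S : Type*} [SetLike S Ω] [SubringClass S Ω] {s : S} {ψ : AddChar (ZMod n) Ω}
    {u : ZMod n → Ω} (hψ : ∀ a, ψ a ∈ s) (hu : ∀ i, u i ∈ s) (a : ZMod n) :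
    fourierSum ψ u a ∈ s :=
  sum_mem fun _ _ ↦ mul_mem (hψ _) (hu _)

theorem mem_of_fourierSum_mem {S : Type*} [SetLike S Ω] [SubfieldClass S Ω] {s : S}
    {ψ : AddChar (ZMod n) Ω} (hp : ψ.IsPrimitive) (hn : (n : Ω) ≠ 0) {u : ZMod n → Ω}
    (hψ : ∀ a, ψ a ∈ s) (hu : ∀ i, fourierSum ψ u i ∈ s) (a : ZMod n) : u a ∈ s := by
  have h := fourierSum_mem hψ hu (-a)
  rw [fourierSum_fourierSum u hp, neg_neg] at h
  simpa [hn] using div_mem h (natCast_mem s n)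

end

/-- A shift-invariant combination of degree one of Fourier coefficients of index
`j`, `3 * j` and `4 * j`. -/
def fourierQuotient (ψ : AddChar (ZMod 7) Ω) (u : ZMod 7 → Ω) (j : ZMod 7) : Ω :=
  fourierSum ψ u j * fourierSum ψ u (3 * j) / fourierSum ψ u (4 * j)

/-- The Fourier transform of `fourierQuotient`, with the sign of the index reversed. -/
def dihedralInvariant (ψ : AddChar (ZMod 7) Ω) (u : ZMod 7 → Ω) (i : ZMod 7) : Ω :=
  fourierSum ψ (fourierQuotient ψ u) (-i)

section
variable (ψ : AddChar (ZMod 7) Ω) (u : ZMod 7 → Ω)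

theorem fourierQuotient_mulShift (c j : ZMod 7) :
    fourierQuotient (ψ.mulShift c) u j = fourierQuotient ψ u (c * j) := by
  simp only [fourierQuotient, fourierSum_mulShift, mul_left_comm c]

theorem dihedralInvariant_mulShift {c : ZMod 7} (hc : IsUnit c) (i : ZMod 7) :
    dihedralInvariant (ψ.mulShift c) u i = dihedralInvariant ψ u i := by
  rw [dihedralInvariant, fourierSum_mulShift]
  simp only [funext (fourierQuotient_mulShift ψ u c)]
  exact fourierSum_comp_unit ψ _ hc _

theorem dihedralInvariant_eq_of_isPrimitive {ψ φ : AddChar (ZMod 7) Ω} (hψ : ψ.IsPrimitive)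
    (hφ : φ.IsPrimitive) : dihedralInvariant φ u = dihedralInvariant ψ u := by
  have : Fact (Nat.Prime 7) := ⟨by norm_num⟩
  obtain ⟨c, hc, rfl⟩ := hψ.exists_mulShift_eq hφ
  exact funext (dihedralInvariant_mulShift ψ u hc.isUnit)

theorem fourierQuotient_shift (c j : ZMod 7) :
    fourierQuotient ψ (fun i ↦ u (i + c)) j = fourierQuotient ψ u j := by
  have h : ψ (-(j * c)) * ψ (-(3 * j * c)) = ψ (-(4 * j * c)) := by
    rw [← AddChar.map_add_eq_mul]
    ring_nf
  have h0 : ψ (-(4 * j * c)) ≠ 0 := (ψ.val_isUnit _).ne_zero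
  simp only [fourierQuotient, fourierSum_shift]
  rw [mul_mul_mul_comm, h, mul_div_mul_left _ _ h0]

theorem dihedralInvariant_shift (c i : ZMod 7) :
    dihedralInvariant ψ (fun i ↦ u (i + c)) i = dihedralInvariant ψ u i := by
  simp only [dihedralInvariant, funext (fourierQuotient_shift ψ u c)]

theorem fourierSum_neg {n : ℕ} [NeZero n] (ψ : AddChar (ZMod n) Ω) (u : ZMod n → Ω) (a : ZMod n) :
    fourierSum ψ (fun i ↦ u (-i)) a = fourierSum ψ u (-a) := by
  simpa using fourierSum_comp_unit ψ u isUnit_one.neg (-a)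

theorem dihedralInvariant_neg (i : ZMod 7) :
    dihedralInvariant ψ (fun i ↦ u (-i)) i = dihedralInvariant ψ u (-i) := by
  have h (j : ZMod 7) :
      fourierQuotient ψ (fun i ↦ u (-i)) j = fourierQuotient ψ u (-j) := by
    simp only [fourierQuotient, fourierSum_neg, mul_neg]
  rw [dihedralInvariant, funext h, fourierSum_neg, dihedralInvariant]

theorem map_fourierQuotient (f : Ω →+* Ω') (j : ZMod 7) :
    f (fourierQuotient ψ u j) =
      fourierQuotient ((f : Ω →* Ω').compAddChar ψ) (f ∘ u) j := by
  simp only [fourierQuotient, map_div₀, map_mul, map_fourierSum]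

theorem map_dihedralInvariant (f : Ω →+* Ω') (i : ZMod 7) :
    f (dihedralInvariant ψ u i) =
      dihedralInvariant ((f : Ω →* Ω').compAddChar ψ) (f ∘ u) i := by
  rw [dihedralInvariant, map_fourierSum, dihedralInvariant]
  exact congrArg (fourierSum _ · _) (funext (map_fourierQuotient ψ u f))

end

theorem fourierQuotient_values (ψ : AddChar (ZMod 7) Ω) (u : ZMod 7 → Ω) :
    fourierQuotient ψ u 1 = fourierSum ψ u 1 * fourierSum ψ u 3 / fourierSum ψ u 4 ∧
    fourierQuotient ψ u 2 = fourierSum ψ u 2 * fourierSum ψ u 6 / fourierSum ψ u 1 ∧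
    fourierQuotient ψ u 3 = fourierSum ψ u 3 * fourierSum ψ u 2 / fourierSum ψ u 5 ∧
    fourierQuotient ψ u 4 = fourierSum ψ u 4 * fourierSum ψ u 5 / fourierSum ψ u 2 ∧
    fourierQuotient ψ u 5 = fourierSum ψ u 5 * fourierSum ψ u 1 / fourierSum ψ u 6 ∧
    fourierQuotient ψ u 6 = fourierSum ψ u 6 * fourierSum ψ u 4 / fourierSum ψ u 3 :=
  ⟨rfl, rfl, rfl, rfl, rfl, rfl⟩

/-- The seventh power of the first Fourier coefficient is a monomial in the Fourier quotients. -/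
theorem fourierSum_one_pow_seven (ψ : AddChar (ZMod 7) Ω) (u : ZMod 7 → Ω)
    (h0 : ∀ a, fourierSum ψ u a ≠ 0) :
    fourierSum ψ u 1 ^ 7 = fourierQuotient ψ u 1 ^ 3 * fourierQuotient ψ u 3 *
      fourierQuotient ψ u 5 ^ 2 * fourierQuotient ψ u 6 ^ 4 /
      (fourierQuotient ψ u 2 ^ 2 * fourierQuotient ψ u 4) := by
  obtain ⟨h1, h2, h3, h4, h5, h6⟩ := fourierQuotient_values ψ u
  rw [h1, h2, h3, h4, h5, h6]
  have := h0 1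
  have := h0 2
  have := h0 3
  have := h0 4
  have := h0 5
  have := h0 6
  field_simp

theorem fourierSum_mem_of_fourierQuotient_mem (ψ : AddChar (ZMod 7) Ω) (u : ZMod 7 → Ω)
    (h0 : ∀ a, fourierSum ψ u a ≠ 0)
    {S : Type*} [SetLike S Ω] [SubfieldClass S Ω] {s : S}
    (hs : ∀ a, fourierQuotient ψ u a ∈ s) (hy1 : fourierSum ψ u 1 ∈ s) (a : ZMod 7) :
    fourierSum ψ u a ∈ s := by
  obtain ⟨h1, h2, h3, h4, h5, h6⟩ := fourierQuotient_values ψ u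
  have h01 := h0 1
  have h02 := h0 2
  have h03 := h0 3
  have h04 := h0 4
  have h05 := h0 5
  have h06 := h0 6
  have hy0 : fourierSum ψ u 0 ∈ s := by
    convert hs 0 using 1
    simp [fourierQuotient, h0]
  have hy6 : fourierSum ψ u 6 ∈ s := by
    convert div_mem (mul_mem (hs 6) (hs 1)) hy1 using 1
    rw [h6, h1]
    field_simp
  have hy2 : fourierSum ψ u 2 ∈ s := by
    convert div_mem (mul_mem (hs 2) hy1) hy6 using 1
    rw [h2]
    field_simp
  have hy5 : fourierSum ψ u 5 ∈ s := by
    convert div_mem (mul_mem (hs 5) hy6) hy1 using 1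
    rw [h5]
    field_simp
  have hy4 : fourierSum ψ u 4 ∈ s := by
    convert div_mem (mul_mem (hs 4) hy2) hy5 using 1
    rw [h4]
    field_simp
  have hy3 : fourierSum ψ u 3 ∈ s := by
    convert div_mem (mul_mem (hs 1) hy4) hy1 using 1
    rw [h1]
    field_simp
  fin_cases a
  exacts [hy0, hy1, hy2, hy3, hy4, hy5, hy6]
end

section
variable {k K E : Type*} [Field k] [Field K] [Field E] [Algebra k K]

theorem AlgebraicIndependent.fourierSum_ne_zero {n : ℕ} [NeZero n] {x : ZMod n → K}
    (hx : AlgebraicIndependent k x) (ψ : AddChar (ZMod n) K) (a : ZMod n) :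
    fourierSum ψ x a ≠ 0 := by
  have hψ (l : ZMod n) : ψ (a * l) ∈ algebraicClosure k K := by
    refine mem_algebraicClosure_iff.2 (IsAlgebraic.of_pow (NeZero.pos n) ?_)
    rw [← AddChar.map_nsmul_eq_pow]
    simpa using isAlgebraic_one
  intro h
  have h0 := Fintype.linearIndependent_iff.1 hx.algebraicClosure.linearIndependent
    (fun l ↦ ⟨ψ (a * l), hψ l⟩) h 0
  exact (ψ.val_isUnit _).ne_zero (congrArg Subtype.val h0)

variable [Algebra K E]

theorem dihedralInvariant_mem_range_algebraMap [IsCyclotomicExtension {7} K E] (x : ZMod 7 → K)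
    {ψ : AddChar (ZMod 7) E} (hψ : ψ.IsPrimitive) (i : ZMod 7) :
    dihedralInvariant ψ (algebraMap K E ∘ x) i ∈ Set.range (algebraMap K E) := by
  have := IsCyclotomicExtension.isGalois {7} K E
  have := IsCyclotomicExtension.finiteDimensional {7} K E
  rw [IsGalois.mem_range_algebraMap_iff_fixed]
  intro γ
  have hγ : (γ : E →+* E) ∘ algebraMap K E ∘ x = algebraMap K E ∘ x := by
    ext i
    simp
  have hprim : (((γ : E →+* E) : E →* E).compAddChar ψ).IsPrimitive :=
    hψ.compMulHom_of_isPrimitive γ.injective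
  have := map_dihedralInvariant ψ (algebraMap K E ∘ x) (γ : E →+* E) i
  rwa [hγ, dihedralInvariant_eq_of_isPrimitive _ hψ hprim] at this

theorem map_eq_dihedralInvariant [Algebra.IsAlgebraic K E] {x z : ZMod 7 → K}
    {ψ : AddChar (ZMod 7) E} (hψ : ψ.IsPrimitive)
    (hz : ∀ i, algebraMap K E (z i) = dihedralInvariant ψ (algebraMap K E ∘ x) i)
    {Ω : Type*} [Field Ω] [IsAlgClosed Ω] (f : K →+* Ω) {φ : AddChar (ZMod 7) Ω}
    (hφ : φ.IsPrimitive) (i : ZMod 7) : f (z i) = dihedralInvariant φ (f ∘ x) i := by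
  let := f.toAlgebra
  let g : E →ₐ[K] Ω := IsAlgClosed.lift
  have hg (a : K) : g (algebraMap K E a) = f a := g.commutes a
  have hgx : (g : E →+* Ω) ∘ algebraMap K E ∘ x = f ∘ x := funext fun i ↦ hg (x i)
  have hprim : (((g : E →+* Ω) : E →* Ω).compAddChar ψ).IsPrimitive :=
    hψ.compMulHom_of_isPrimitive (g : E →+* Ω).injective
  rw [← hg, hz, dihedralInvariant_eq_of_isPrimitive _ hprim hφ, ← hgx]
  exact map_dihedralInvariant ψ _ (g : E →+* Ω) i

theorem map_dihedralInvariant_of_lift [Algebra.IsAlgebraic K E] {x z : ZMod 7 → K}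
    {ψ : AddChar (ZMod 7) E} (hψ : ψ.IsPrimitive)
    (hz : ∀ i, algebraMap K E (z i) = dihedralInvariant ψ (algebraMap K E ∘ x) i)
    (σ : K →+* K) {y : ZMod 7 → K} (hσ : ∀ i, σ (x i) = y i) {i j : ZMod 7}
    (hxy : ∀ (φ : AddChar (ZMod 7) (AlgebraicClosure E)), dihedralInvariant φ
      (algebraMap K (AlgebraicClosure E) ∘ y) i =
      dihedralInvariant φ (algebraMap K (AlgebraicClosure E) ∘ x) j) :
    σ (z i) = z j := by
  let φ := ((algebraMap E (AlgebraicClosure E)) : E →* AlgebraicClosure E).compAddChar ψ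
  have hφ : φ.IsPrimitive :=
    hψ.compMulHom_of_isPrimitive (algebraMap E (AlgebraicClosure E)).injective
  refine (algebraMap K (AlgebraicClosure E)).injective ?_
  have h1 := map_eq_dihedralInvariant hψ hz ((algebraMap K (AlgebraicClosure E)).comp σ) hφ i
  have h2 := map_eq_dihedralInvariant hψ hz (algebraMap K (AlgebraicClosure E)) hφ j
  rw [h2, ← hxy, ← funext hσ]
  exact h1

/-- The minimal polynomial of an algebraic constant over a purely transcendental extension has
constant coefficients. -/
theorem exists_monic_aeval_eq_zero_of_isIntegral [Algebra k E] [IsScalarTower k K E] {ι : Type*}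
    {x : ι → K} (hx : AlgebraicIndependent k x) (hgen : adjoin k (Set.range x) = ⊤) {a : E}
    (ha : IsIntegral k a) :
    ∃ q : Polynomial k, q.Monic ∧ Polynomial.aeval a q = 0 ∧
      q.natDegree = (minpoly K a).natDegree := by
  have haK : IsIntegral K a := ha.tower_top
  have hlift : minpoly K a ∈ Polynomial.lifts (algebraMap k K) := by
    rw [Polynomial.lifts_iff_coeff_lifts]
    intro n
    refine hx.mem_range_algebraMap_of_isAlgebraic ?_ (hgen ▸ mem_top)
    exact (Polynomial.isIntegral_coeff_of_dvd (minpoly k a) _ (minpoly.monic ha)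
      (minpoly.monic haK) (minpoly.dvd_map_of_isScalarTower k K a) n).isAlgebraic
  obtain ⟨q, hq, hdeg, hmonic⟩ :=
    Polynomial.lifts_and_natDegree_eq_and_monic hlift (minpoly.monic haK)
  refine ⟨q, hmonic, ?_, hdeg⟩
  rw [← Polynomial.aeval_map_algebraMap K, hq, minpoly.aeval]

end

section
variable {k K E : Type*} [Field k] [Field K] [Field E] [Algebra k K] [Algebra K E]

theorem finite_and_finrank_le_of_dihedralInvariant [Algebra k E] [IsScalarTower k K E]
    [IsCyclotomicExtension {7} K E] {x z : ZMod 7 → K} (hx : AlgebraicIndependent k x)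
    (hgen : adjoin k (Set.range x) = ⊤) {ζ : E} (hζ : IsPrimitiveRoot ζ 7)
    (hz : ∀ i, algebraMap K E (z i) =
      dihedralInvariant (AddChar.zmodChar 7 hζ.pow_eq_one) (algebraMap K E ∘ x) i) :
    FiniteDimensional (adjoin k (Set.range z)) K ∧ finrank (adjoin k (Set.range z)) K ≤ 7 := by
  set ψ := AddChar.zmodChar 7 hζ.pow_eq_one
  have hψ : ψ.IsPrimitive := AddChar.zmodChar_primitive_of_primitive_root 7 hζ
  have h7 : ((7 : ℕ) : E) ≠ 0 := hζ.neZero'.out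
  set u := algebraMap K E ∘ x
  have hu0 : ∀ a, fourierSum ψ u a ≠ 0 :=
    (hx.map' (f := IsScalarTower.toAlgHom k K E) (algebraMap K E).injective).fourierSum_ne_zero ψ
  set F := adjoin k (Set.range z)
  have hfinKE := IsCyclotomicExtension.finiteDimensional {7} K E
  have hζk : IsIntegral k ζ := (hζ.isIntegral (by norm_num)).tower_top
  obtain ⟨q, hq, hqζ, hqdeg⟩ := exists_monic_aeval_eq_zero_of_isIntegral hx hgen hζk
  have hKE : q.natDegree = finrank K E := by
    rw [hqdeg, (hζ.powerBasis K).finrank, ← (hζ.powerBasis K).natDegree_minpoly,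
      hζ.powerBasis_gen K]
  obtain ⟨hfin1, hdeg1⟩ : FiniteDimensional F F⟮ζ⟯ ∧ finrank F F⟮ζ⟯ ≤ finrank K E := by
    rw [← hKE, ← hq.natDegree_map (algebraMap k F)]
    refine finite_and_finrank_le_of_le_adjoin_simple (hq.map _) ?_ le_rfl
    rw [Polynomial.aeval_map_algebraMap, hqζ]
  have hζF : ζ ∈ F⟮ζ⟯ := mem_adjoin_simple_self F ζ
  have hψF (a : ZMod 7) : ψ a ∈ F⟮ζ⟯ := by
    rw [AddChar.zmodChar_apply]
    exact pow_mem hζF _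
  have hm : ∀ a, fourierQuotient ψ u a ∈ F⟮ζ⟯ := by
    refine mem_of_fourierSum_mem hψ h7 hψF fun i ↦ ?_
    rw [← neg_neg i, ← dihedralInvariant, ← hz]
    exact IntermediateField.algebraMap_mem F⟮ζ⟯ (⟨z (-i), subset_adjoin _ _ ⟨-i, rfl⟩⟩ : F)
  obtain ⟨hfin2, hdeg2⟩ : FiniteDimensional F⟮ζ⟯ E ∧ finrank F⟮ζ⟯ E ≤ 7 := by
    have hc : fourierSum ψ u 1 ^ 7 ∈ F⟮ζ⟯ := by
      rw [fourierSum_one_pow_seven ψ u hu0]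
      exact div_mem (mul_mem (mul_mem (mul_mem (pow_mem (hm _) _) (hm _)) (pow_mem (hm _) _))
        (pow_mem (hm _) _)) (mul_mem (pow_mem (hm _) _) (hm _))
    rw [← Polynomial.natDegree_X_pow_sub_C (n := 7) (r := (⟨_, hc⟩ : F⟮ζ⟯))]
    refine finite_and_finrank_le_of_adjoin_simple_eq_top (a := fourierSum ψ u 1)
      (Polynomial.monic_X_pow_sub_C _ (by norm_num)) ?_ ?_
    · simp
    · set L := F⟮ζ⟯⟮fourierSum ψ u 1⟯
      have hFL {a : E} (ha : a ∈ F⟮ζ⟯) : a ∈ L :=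
        IntermediateField.algebraMap_mem L (⟨a, ha⟩ : F⟮ζ⟯)
      have hxL : ∀ i, u i ∈ L :=
        mem_of_fourierSum_mem hψ h7 (fun a ↦ hFL (hψF a)) fun a ↦
          fourierSum_mem_of_fourierQuotient_mem ψ u hu0 (fun a ↦ hFL (hm a))
            (mem_adjoin_simple_self _ _) a
      have hKL (a : K) : algebraMap K E a ∈ L := by
        have : ((L.restrictScalars F).restrictScalars k).comap (IsScalarTower.toAlgHom k K E) = ⊤ :=
          eq_top_of_range_subset hgen hxL
        exact (this ▸ mem_top : a ∈ ((L.restrictScalars F).restrictScalars k).comap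
          (IsScalarTower.toAlgHom k K E))
      rw [eq_top_iff]
      intro a _
      have ha : a ∈ Algebra.adjoin K {ζ} := by
        rw [IsCyclotomicExtension.adjoin_primitive_root_eq_top hζ]
        trivial
      induction ha using Algebra.adjoin_induction with
      | mem a ha => exact hFL (Set.mem_singleton_iff.1 ha ▸ hζF)
      | algebraMap a => exact hKL a
      | add a b _ _ ha hb => exact add_mem (ha trivial) (hb trivial)
      | mul a b _ _ ha hb => exact mul_mem (ha trivial) (hb trivial)
  have hfinFE : FiniteDimensional F E := .trans F F⟮ζ⟯ E
  have hfinFK : FiniteDimensional F K := .left F K E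
  refine ⟨hfinFK, Nat.le_of_mul_le_mul_right (c := finrank K E) ?_ finrank_pos⟩
  rw [finrank_mul_finrank F K E, ← finrank_mul_finrank F F⟮ζ⟯ E, mul_comm 7]
  exact Nat.mul_le_mul hdeg1 hdeg2

theorem exists_invariants_of_natCast_seven_ne_zero (h7 : ((7 : ℕ) : K) ≠ 0) {x : ZMod 7 → K}
    (hx : AlgebraicIndependent k x) (hgen : adjoin k (Set.range x) = ⊤) {σ τ : K ≃ₐ[k] K}
    (hσ : ∀ i, σ (x i) = x (i + 1)) (hτ : ∀ i, τ (x i) = x (-i)) :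
    ∃ z : ZMod 7 → K, (∀ i, σ (z i) = z i) ∧ (∀ i, τ (z i) = z (-i)) ∧
      FiniteDimensional (adjoin k (Set.range z)) K ∧
      finrank (adjoin k (Set.range z)) K ≤ 7 := by
  have : NeZero ((7 : ℕ) : K) := ⟨h7⟩
  let E := CyclotomicField 7 K
  have := IsCyclotomicExtension.finiteDimensional {7} K E
  have hζ := IsCyclotomicExtension.zeta_spec 7 K E
  have hψ := AddChar.zmodChar_primitive_of_primitive_root 7 hζ
  choose z hz using dihedralInvariant_mem_range_algebraMap x hψ
  exact ⟨z, fun i ↦ map_dihedralInvariant_of_lift hψ hz σ hσ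
      fun φ ↦ dihedralInvariant_shift φ (algebraMap K _ ∘ x) 1 i,
    fun i ↦ map_dihedralInvariant_of_lift hψ hz τ hτ
      fun φ ↦ dihedralInvariant_neg φ (algebraMap K _ ∘ x) i,
    finite_and_finrank_le_of_dihedralInvariant hx hgen hζ hz⟩

end

/-- The fixed field of the dihedral group `D₇ = ⟨σ, ρ⟩` with `σ : xᵢ ↦ x_{i+1}`, `ρ : xᵢ ↦ x_{-i}` (indices mod 7) acting on the rational function field in 7 variables is purely transcendental over any field `k`. -/
theorem D7_fixed_field_rational
    (k K : Type*) [Field k] [Field K] [Algebra k K]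
    (x : ZMod 7 → K) (hx : AlgebraicIndependent k x)
    (hgen : IntermediateField.adjoin k (Set.range x) = ⊤)
    (σ τ : K ≃ₐ[k] K)
    (hσ : ∀ i : ZMod 7, σ (x i) = x (i + 1))
    (hτ : ∀ i : ZMod 7, τ (x i) = x (-i)) :
    IsRationalExtension k
      (IntermediateField.fixedField (Subgroup.closure {σ, τ})) := by
  obtain ⟨z, hzσ, hzτ, hfin, hdeg⟩ : ∃ z : ZMod 7 → K, (∀ i, σ (z i) = z i) ∧
      (∀ i, τ (z i) = z (-i)) ∧ FiniteDimensional (adjoin k (Set.range z)) K ∧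
      finrank (adjoin k (Set.range z)) K ≤ 7 := by
    by_cases h7 : ((7 : ℕ) : K) = 0
    · have := (CharP.charP_iff_prime_eq_zero (by norm_num)).2 h7
      exact exists_invariants_of_charP_seven hx hgen hσ hτ
    · exact exists_invariants_of_natCast_seven_ne_zero h7 hx hgen hσ hτ
  exact isRationalExtension_of_invariants hx hgen hσ hτ hzσ hzτ hdeg
end
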